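/- For all integers r ≥ 3 and t ≥ r+3 there exist real constants c, C > 0, an integer N, and functions f, g from the natural numbers to the natural numbers with f(n)/n → 1 and g(n)/n → 1 as n → ∞, such that for every integer n ≥ N: (a) every K_r-saturated graph G on n vertices with minimum degree at least t, in which for every pair of distinct twin vertices there is a vertex of degree exactly t adjacent to both of them, satisfies e(G) ≥ t·n + c·e'_{r,t}(f(n)); and (b) there exists a K_r-saturated graph G on n vertices with minimum degree at least t, in which every pair of distinct twin vertices has a common neighbour of degree exactly t, satisfying e(G) ≤ t·n + C·e'_{r,t}(g(n)). -/

import Mathlib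

open SimpleGraph

/-- `G` is `K_r`-saturated: `G` contains no `r`-clique, but adding any missing edge
creates an `r`-clique. -/
def Ksat (r : ℕ) {V : Type*} (G : SimpleGraph V) : Prop :=
  G.CliqueFree r ∧ ∀ u v : V, u ≠ v → ¬ G.Adj u v →
    ¬ (G ⊔ fromEdgeSet {s(u, v)}).CliqueFree r

/-- `G` is twin-free: distinct vertices have distinct neighbourhoods. -/
def TwinFree {V : Type*} (G : SimpleGraph V) : Prop :=
  ∀ u v : V, G.neighborSet u = G.neighborSet v → u = v

/-- Minimum degree of `G` is at least `t`. -/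
def MinDegGe {V : Type*} (G : SimpleGraph V) (t : ℕ) : Prop :=
  ∀ v : V, t ≤ (G.neighborSet v).ncard

/-- Every pair of distinct twins has a common neighbour of degree exactly `t`. -/
def TwinCond {V : Type*} (G : SimpleGraph V) (t : ℕ) : Prop :=
  ∀ u v : V, u ≠ v → G.neighborSet u = G.neighborSet v →
    ∃ w : V, (G.neighborSet w).ncard = t ∧ G.Adj w u ∧ G.Adj w v

/-- An `(r,t)`-system. -/
def IsRTSystem (r t : ℕ) {V : Type*} [DecidableEq V] (H : SimpleGraph V)
    (F : Finset (Finset V)) : Prop :=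
  H.CliqueFree r ∧
  (∀ S ∈ F, S.card = t ∧
    (H.induce (S : Set V)).CliqueFree (r - 1) ∧
    ∀ v : V, v ∉ S → ¬ (H.induce ((insert v S : Finset V) : Set V)).CliqueFree (r - 1)) ∧
  (∀ S ∈ F, ∀ T ∈ F, S ≠ T → ¬ (H.induce ((S ∩ T : Finset V) : Set V)).CliqueFree (r - 2))

/-- A maximal `(r,t)`-system. -/
def IsMaxRTSystem (r t : ℕ) {V : Type*} [DecidableEq V] (H : SimpleGraph V)
    (F : Finset (Finset V)) : Prop :=
  IsRTSystem r t H F ∧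
  ∀ u v : V, u ≠ v → ¬ H.Adj u v →
    ¬ (H ⊔ fromEdgeSet {s(u, v)}).CliqueFree r ∨
    ∃ S ∈ F, ¬ (((H ⊔ fromEdgeSet {s(u, v)}).induce (S : Set V)).CliqueFree (r - 1))

/-- A `(3,t)`-system. -/
def Is3TSystem (t : ℕ) {V : Type*} [DecidableEq V] (H : SimpleGraph V)
    (F : Finset (Finset V)) : Prop :=
  H.CliqueFree 3 ∧
  (∀ S ∈ F, S.card = t ∧
    (∀ u ∈ S, ∀ v ∈ S, ¬ H.Adj u v) ∧
    (∀ v : V, v ∉ S → ∃ u ∈ S, H.Adj v u)) ∧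
  (∀ S ∈ F, ∀ T ∈ F, S ≠ T → (S ∩ T).Nonempty)

/-- A maximal `(3,t)`-system. -/
def IsMax3TSystem (t : ℕ) {V : Type*} [DecidableEq V] (H : SimpleGraph V)
    (F : Finset (Finset V)) : Prop :=
  Is3TSystem t H F ∧
  ∀ u v : V, u ≠ v → ¬ H.Adj u v →
    ¬ (H ⊔ fromEdgeSet {s(u, v)}).CliqueFree 3 ∨ ∃ S ∈ F, u ∈ S ∧ v ∈ S

noncomputable def s3 (t m : ℕ) : ℕ :=
  sSup {a : ℕ | ∃ (H : SimpleGraph (Fin m)) (F : Finset (Finset (Fin m))),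
    Is3TSystem t H F ∧ F.card = a}

noncomputable def ePrime (r t s : ℕ) : ℕ :=
  sInf {e : ℕ | ∃ (m : ℕ) (H : SimpleGraph (Fin m)) (F : Finset (Finset (Fin m))),
    IsMaxRTSystem r t H F ∧ F.card = s ∧ H.edgeSet.ncard = e}

noncomputable def e3min (t s : ℕ) : ℕ :=
  sInf {e : ℕ | ∃ (m : ℕ) (H : SimpleGraph (Fin m)) (F : Finset (Finset (Fin m))),
    Is3TSystem t H F ∧ F.card = s ∧ H.edgeSet.ncard = e}


section

open Finset
open scoped Classical

theorem not_cliqueFree_iff_exists {V : Type*} {G : SimpleGraph V} {n : ℕ} :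
    ¬ G.CliqueFree n ↔ ∃ c : Finset V, G.IsNClique n c := by
  simp [CliqueFree]

theorem not_cliqueFree_induce_iff {V : Type*} {G : SimpleGraph V} {S : Set V} {n : ℕ} :
    ¬ (G.induce S).CliqueFree n ↔ ∃ c : Finset V, (c : Set V) ⊆ S ∧ G.IsNClique n c := by
  rw [cliqueFree_induce_iff]
  simp [CliqueFreeOn]

/-- A clique created by adding the edge `uv` is a clique in the common neighbourhood of `u` and
`v` together with these two vertices. -/
theorem isNClique_erase_of_sup_edge {V : Type*} {G : SimpleGraph V} {u v : V} (huv : u ≠ v)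
    {c : Finset V} {n : ℕ} (hc : (G ⊔ fromEdgeSet {s(u, v)}).IsNClique (n + 2) c)
    (hn : ¬ G.IsNClique (n + 2) c) :
    u ∈ c ∧ v ∈ c ∧ ∃ d ⊆ c, G.IsNClique n d ∧ ∀ x ∈ d, G.Adj u x ∧ G.Adj v x := by
  have key : ∀ x ∈ c, ∀ y ∈ c, x ≠ y → ¬ (x = u ∧ y = v) → ¬ (x = v ∧ y = u) → G.Adj x y := by
    intro x hx y hy hxy h1 h2
    have := hc.1 hx hy hxy
    simp only [sup_adj, fromEdgeSet_adj, Set.mem_singleton_iff, Sym2.eq_iff] at this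
    tauto
  have hu : u ∈ c := by
    by_contra hu
    refine hn ⟨fun x hx y hy hxy => key x hx y hy hxy ?_ ?_, hc.2⟩
    · rintro ⟨rfl, -⟩; exact hu hx
    · rintro ⟨-, rfl⟩; exact hu hy
  have hv : v ∈ c := by
    by_contra hv
    refine hn ⟨fun x hx y hy hxy => key x hx y hy hxy ?_ ?_, hc.2⟩
    · rintro ⟨-, rfl⟩; exact hv hy
    · rintro ⟨rfl, -⟩; exact hv hx
  refine ⟨hu, hv, (c.erase u).erase v, (erase_subset _ _).trans (erase_subset _ _),
    ⟨fun x hx y hy hxy => ?_, ?_⟩, fun x hx => ?_⟩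
  · simp only [coe_erase, Set.mem_sdiff, mem_coe, Set.mem_singleton_iff] at hx hy
    exact key x hx.1.1 y hy.1.1 hxy (by tauto) (by tauto)
  · rw [card_erase_of_mem (by simp [hv, huv.symm]), card_erase_of_mem hu, hc.2]
    omega
  · simp only [mem_erase] at hx
    exact ⟨key u hu x hx.2.2 (Ne.symm hx.2.1) (by tauto) (by tauto),
      key v hv x hx.2.2 (Ne.symm hx.1) (by tauto) (by tauto)⟩

theorem exists_isNClique_sup_edge {V : Type*} {G : SimpleGraph V} {u v : V} (huv : u ≠ v)
    {d : Finset V} {n : ℕ} (hd : G.IsNClique n d) (h : ∀ x ∈ d, G.Adj u x ∧ G.Adj v x) :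
    ∃ c : Finset V, (G ⊔ fromEdgeSet {s(u, v)}).IsNClique (n + 2) c ∧
      ∀ x ∈ c, x = u ∨ x = v ∨ x ∈ d := by
  refine ⟨insert u (insert v d),
    ((hd.mono le_sup_left).insert fun b hb => ?_).insert fun b hb => ?_, by simp⟩
  · exact Or.inl (h b hb).2
  · rcases mem_insert.1 hb with rfl | hb
    · right; simp [huv]
    · exact Or.inl (h b hb).1

/-- `G` lives on the vertex set `W`, is `K_{k+2}`-free, and any two distinct non-adjacent vertices
of `W` have a `k`-clique in their common neighbourhood. -/
structure SatOn (k : ℕ) {V : Type} (G : SimpleGraph V) (W : Finset V) : Prop where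
  supp : ∀ u v, G.Adj u v → u ∈ W
  free : G.CliqueFree (k + 2)
  sat : ∀ u ∈ W, ∀ v ∈ W, u ≠ v → ¬ G.Adj u v →
    ∃ d : Finset V, G.IsNClique k d ∧ ∀ x ∈ d, G.Adj u x ∧ G.Adj v x

/-- A saturated graph on `W` with a distinguished independent set `I` of vertices of degree `t`
having pairwise distinct neighbourhoods. -/
structure Conf (k t : ℕ) {V : Type} [Fintype V] (G : SimpleGraph V) (W I : Finset V) : Prop
    extends SatOn k G W where
  sub : I ⊆ W
  indep : ∀ u ∈ I, ∀ v ∈ I, ¬ G.Adj u v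
  deg : ∀ u ∈ I, G.degree u = t
  inj : ∀ u ∈ I, ∀ v ∈ I, (∀ x, G.Adj u x ↔ G.Adj v x) → u = v

theorem Ksat.satOn_univ {k : ℕ} {V : Type} [Fintype V] {G : SimpleGraph V} (h : Ksat (k + 2) G) :
    SatOn k G univ := by
  refine ⟨fun _ _ _ => mem_univ _, h.1, fun u _ v _ huv hadj => ?_⟩
  obtain ⟨c, hc⟩ := not_cliqueFree_iff_exists.1 (h.2 u v huv hadj)
  obtain ⟨-, -, d, -, hd⟩ := isNClique_erase_of_sup_edge huv hc (h.1 c)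
  exact ⟨d, hd⟩

theorem SatOn.ksat_of_univ {k : ℕ} {V : Type} [Fintype V] {G : SimpleGraph V}
    (h : SatOn k G univ) : Ksat (k + 2) G := by
  refine ⟨h.free, fun u v huv hadj => ?_⟩
  obtain ⟨d, hd, hd'⟩ := h.sat u (mem_univ _) v (mem_univ _) huv hadj
  obtain ⟨c, hc, -⟩ := exists_isNClique_sup_edge huv hd hd'
  exact hc.not_cliqueFree

theorem card_edgeFinset_le_add_sum_degree {V : Type} [Fintype V] (G G₀ : SimpleGraph V)
    (J : Finset V) (h : ∀ x y, G.Adj x y → x ∉ J → y ∉ J → G₀.Adj x y) :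
    #G.edgeFinset ≤ #G₀.edgeFinset + ∑ v ∈ J, G.degree v := by
  have hsub : G.edgeFinset ⊆ G₀.edgeFinset ∪ J.biUnion fun v => G.incidenceFinset v := by
    intro e he
    induction e with
    | h x y =>
      simp only [mem_edgeFinset, mem_edgeSet, mem_union, mem_biUnion, mem_incidenceFinset,
        mk'_mem_incidenceSet_iff] at he ⊢
      by_cases hx : x ∈ J
      · exact Or.inr ⟨x, hx, he, Or.inl rfl⟩
      by_cases hy : y ∈ J
      · exact Or.inr ⟨y, hy, he, Or.inr rfl⟩
      exact Or.inl (h x y he hx hy)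
  refine (card_le_card hsub).trans ((card_union_le _ _).trans ?_)
  gcongr
  refine card_biUnion_le.trans (le_of_eq ?_)
  simp [card_incidenceFinset_eq_degree]

theorem card_edgeFinset_add_sum_degree_le {V : Type} [Fintype V] (G G₀ : SimpleGraph V)
    (J : Finset V) (hle : G₀ ≤ G) (h₀ : ∀ x ∈ J, ∀ y, ¬ G₀.Adj x y)
    (hJ : ∀ x ∈ J, ∀ y ∈ J, ¬ G.Adj x y) :
    #G₀.edgeFinset + ∑ v ∈ J, G.degree v ≤ #G.edgeFinset := by
  have hdisj : Set.PairwiseDisjoint (J : Set V) fun v => G.incidenceFinset v := by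
    intro x hx y hy hxy
    rw [Function.onFun, Finset.disjoint_left]
    intro e
    induction e with
    | h a b =>
      simp only [mem_incidenceFinset, mk'_mem_incidenceSet_iff]
      rintro ⟨hab, rfl | rfl⟩ ⟨-, rfl | rfl⟩
      · exact hxy rfl
      · exact hJ _ hx _ hy hab
      · exact hJ _ hy _ hx hab
      · exact hxy rfl
  have hcard : ∑ v ∈ J, G.degree v = #(J.biUnion fun v => G.incidenceFinset v) := by
    rw [card_biUnion hdisj]
    simp [card_incidenceFinset_eq_degree]
  rw [hcard, ← card_union_of_disjoint]
  · refine card_le_card (union_subset (by simpa using hle) ?_)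
    exact biUnion_subset.2 fun v _ => G.incidenceFinset_subset v
  · rw [Finset.disjoint_left]
    intro e
    induction e with
    | h a b =>
      simp only [mem_edgeFinset, mem_edgeSet, mem_biUnion, mem_incidenceFinset,
        mk'_mem_incidenceSet_iff]
      rintro hab ⟨v, hv, -, rfl | rfl⟩
      · exact h₀ _ hv _ hab
      · exact h₀ _ hv _ hab.symm

theorem card_edgeFinset_map_embedding {V U : Type} (G : SimpleGraph V)
    (f : V ↪ U) [Fintype G.edgeSet] [Fintype (G.map f).edgeSet] :
    #(G.map f).edgeFinset = #G.edgeFinset := by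
  have h : (G.map f).edgeSet = f.sym2Map '' G.edgeSet := edgeSet_map f G
  have h1 : #(G.map f).edgeFinset = (G.map f).edgeSet.ncard := by
    rw [Set.ncard_eq_toFinset_card', edgeFinset]
  have h2 : #G.edgeFinset = G.edgeSet.ncard := by
    rw [Set.ncard_eq_toFinset_card', edgeFinset]
  rw [h1, h2, h, Set.ncard_image_of_injective _ f.sym2Map.injective]

theorem card_univ_sdiff_eq {V : Type} [Fintype V] (I : Finset V) :
    #(univ \ I) = Fintype.card V - #I := by
  rw [card_sdiff_of_subset (subset_univ _), card_univ]

theorem ncard_edgeSet {V : Type} [Fintype V] (G : SimpleGraph V) :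
    G.edgeSet.ncard = #G.edgeFinset := by
  rw [Set.ncard_eq_toFinset_card', edgeFinset]

theorem ncard_neighborSet {V : Type} [Fintype V] (G : SimpleGraph V) (v : V) :
    (G.neighborSet v).ncard = G.degree v := by
  rw [Set.ncard_eq_toFinset_card', ← card_neighborFinset_eq_degree, neighborFinset]

end

section

open Finset
open scoped Classical

/-- Attaching a vertex of degree `t` to each member of the family of a maximal system produces a
saturated graph. -/
theorem exists_conf_of_isMaxRTSystem {k t m : ℕ} (hk : 1 ≤ k) {H : SimpleGraph (Fin m)}
    {F : Finset (Finset (Fin m))} (h : IsMaxRTSystem (k + 2) t H F) :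
    ∃ (V : Type) (_ : Fintype V) (G : SimpleGraph V) (I : Finset V), Conf k t G univ I ∧
      #I = #F ∧ #(univ \ I) = m ∧ #G.edgeFinset ≤ H.edgeSet.ncard + t * #F := by
  obtain ⟨⟨hfree, hF, hFF⟩, hmax⟩ := h
  let A : Fin m ⊕ F → Fin m ⊕ F → Prop
    | .inl u, .inl v => H.Adj u v
    | .inl u, .inr S => u ∈ S.1
    | .inr S, .inl u => u ∈ S.1
    | .inr _, .inr _ => False
  let G : SimpleGraph (Fin m ⊕ F) :=
    { Adj := A
      symm := ⟨by
        rintro (u | S) (v | T) h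
        · exact H.symm.symm _ _ h
        · exact h
        · exact h
        · exact h⟩
      loopless := ⟨by
        rintro (u | S) h
        · exact H.loopless.irrefl _ h
        · exact h⟩ }
  have hll : ∀ u v, G.Adj (.inl u) (.inl v) ↔ H.Adj u v := fun _ _ => Iff.rfl
  have hlr : ∀ u S, G.Adj (.inl u) (.inr S) ↔ u ∈ S.1 := fun _ _ => Iff.rfl
  have hrl : ∀ u S, G.Adj (.inr S) (.inl u) ↔ u ∈ S.1 := fun _ _ => Iff.rfl
  have hrr : ∀ S T, ¬ G.Adj (.inr S) (.inr T) := fun _ _ h => h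
  have hmapclique : ∀ n (d : Finset (Fin m)), H.IsNClique n d →
      G.IsNClique n (d.map Function.Embedding.inl) := by
    intro n d hd
    refine ⟨?_, by rw [card_map, hd.2]⟩
    intro x hx y hy hxy
    simp only [coe_map, Set.mem_image, mem_coe] at hx hy
    obtain ⟨x, hx, rfl⟩ := hx
    obtain ⟨y, hy, rfl⟩ := hy
    exact hd.1 hx hy (by rintro rfl; exact hxy rfl)
  have hleft : ∀ c : Finset (Fin m ⊕ F), G.IsClique c → H.IsClique c.toLeft := by
    intro c hc x hx y hy hxy
    simp only [mem_coe, mem_toLeft] at hx hy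
    exact hc hx hy (by simpa using hxy)
  have hdegr : ∀ S, G.degree (.inr S) = t := by
    intro S
    rw [← (hF S.1 S.2).1, ← card_neighborFinset_eq_degree]
    have : G.neighborFinset (.inr S) = S.1.map Function.Embedding.inl := by
      ext x
      rcases x with x | T
      · simp [hrl]
      · simp [hrr]
    rw [this, card_map]
  refine ⟨Fin m ⊕ F, inferInstance, G, univ.map Function.Embedding.inr,
    ⟨⟨fun _ _ _ => mem_univ _, ?_, ?_⟩, subset_univ _, ?_, ?_, ?_⟩, ?_, ?_, ?_⟩
  · intro c hc
    by_cases hr : c.toRight = ∅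
    · refine hfree c.toLeft ⟨hleft c hc.1, ?_⟩
      rw [← hc.2, ← card_toLeft_add_card_toRight (u := c), hr, card_empty, add_zero]
    · obtain ⟨S, hS⟩ := nonempty_iff_ne_empty.2 hr
      have h1 : c.toRight = {S} := by
        refine eq_singleton_iff_unique_mem.2 ⟨hS, fun T hT => ?_⟩
        by_contra hTS
        rw [mem_toRight] at hT hS
        exact hrr _ _ (hc.1 hT hS (by simpa using hTS))
      have h2 : #c.toLeft = k + 1 := by
        have := card_toLeft_add_card_toRight (u := c)
        rw [h1, hc.2, card_singleton] at this
        omega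
      refine (not_cliqueFree_induce_iff.2 ⟨c.toLeft, ?_, hleft c hc.1, h2⟩) (hF S.1 S.2).2.1
      intro x hx
      rw [mem_coe, mem_toLeft] at hx
      rw [mem_toRight] at hS
      exact (hlr _ _).1 (hc.1 hx hS (by simp))
  · have hsat : ∀ u S, ¬ u ∈ S.1 → ∃ d : Finset (Fin m ⊕ F), G.IsNClique k d ∧
        ∀ x ∈ d, G.Adj (.inl u) x ∧ G.Adj (.inr S) x := by
      intro u S hu
      obtain ⟨c, hcS, hc⟩ := not_cliqueFree_induce_iff.1 ((hF S.1 S.2).2.2 u hu)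
      have huc : u ∈ c := by
        by_contra huc
        refine not_cliqueFree_induce_iff.2 ⟨c, fun x hx => ?_, hc⟩ (hF S.1 S.2).2.1
        have := hcS hx
        rw [mem_coe, mem_insert] at this
        rcases this with rfl | h
        · exact absurd hx huc
        · exact h
      refine ⟨(c.erase u).map Function.Embedding.inl,
        hmapclique _ _ (by simpa using hc.erase_of_mem huc), fun x hx => ?_⟩
      simp only [mem_map, mem_erase] at hx
      obtain ⟨x, ⟨hxu, hx⟩, rfl⟩ := hx
      refine ⟨hc.1 huc hx (Ne.symm hxu), ?_⟩
      have := hcS hx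
      rw [mem_coe, mem_insert] at this
      exact this.resolve_left hxu
    rintro (u | S) - (v | T) - huv hadj
    · have huv' : u ≠ v := by simpa using huv
      rcases hmax u v huv' hadj with h | ⟨S, hS, h⟩
      · obtain ⟨c, hc⟩ := not_cliqueFree_iff_exists.1 h
        obtain ⟨-, -, d, -, hd, hd'⟩ := isNClique_erase_of_sup_edge huv' hc (hfree c)
        refine ⟨_, hmapclique _ _ hd, fun x hx => ?_⟩
        obtain ⟨x, hxd, rfl⟩ := mem_map.1 hx
        exact hd' x hxd
      · obtain ⟨c, hcS, hc⟩ := not_cliqueFree_induce_iff.1 h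
        obtain ⟨j, rfl⟩ : ∃ j, k = j + 1 := ⟨k - 1, by omega⟩
        have hn : ¬ H.IsNClique (j + 2) c := fun hc' =>
          not_cliqueFree_induce_iff.2 ⟨c, hcS, hc'⟩ (hF S hS).2.1
        obtain ⟨hu, hv, d, hdc, hd, hd'⟩ := isNClique_erase_of_sup_edge huv' hc hn
        refine ⟨insert (.inr ⟨S, hS⟩) (d.map Function.Embedding.inl),
          (hmapclique _ _ hd).insert fun x hx => ?_, fun x hx => ?_⟩
        · obtain ⟨x, hxd, rfl⟩ := mem_map.1 hx
          exact hcS (hdc hxd)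
        · rcases mem_insert.1 hx with rfl | hx
          · exact ⟨hcS hu, hcS hv⟩
          · obtain ⟨x, hxd, rfl⟩ := mem_map.1 hx
            exact hd' x hxd
    · exact hsat u T hadj
    · obtain ⟨d, hd, hd'⟩ := hsat v S hadj
      exact ⟨d, hd, fun x hx => (hd' x hx).symm⟩
    · have hST : S.1 ≠ T.1 := fun h => huv (by rw [Subtype.ext h])
      obtain ⟨d, hdS, hd⟩ := not_cliqueFree_induce_iff.1 (hFF S.1 S.2 T.1 T.2 hST)
      refine ⟨_, hmapclique _ _ hd, fun x hx => ?_⟩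
      obtain ⟨x, hxd, rfl⟩ := mem_map.1 hx
      have := hdS hxd
      rw [mem_coe, mem_inter] at this
      exact this
  · intro u hu v hv
    obtain ⟨S, -, rfl⟩ := mem_map.1 hu
    obtain ⟨T, -, rfl⟩ := mem_map.1 hv
    exact hrr _ _
  · intro u hu
    obtain ⟨S, -, rfl⟩ := mem_map.1 hu
    exact hdegr S
  · intro u hu v hv huv
    obtain ⟨S, -, rfl⟩ := mem_map.1 hu
    obtain ⟨T, -, rfl⟩ := mem_map.1 hv
    congr 1
    refine Subtype.ext (Finset.ext fun x => ?_)
    exact huv (.inl x)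
  · simp
  · rw [card_univ_sdiff_eq]
    simp
  · refine (card_edgeFinset_le_add_sum_degree G (H.map Function.Embedding.inl)
      (univ.map Function.Embedding.inr) ?_).trans ?_
    · rintro (u | S) (v | T) hadj hx hy
      · rw [map_adj]; exact ⟨u, v, hadj, rfl, rfl⟩
      · simp at hy
      · simp at hx
      · simp at hx
    · rw [card_edgeFinset_map_embedding, sum_map]
      have hsum : ∑ S : F, G.degree (Sum.inr S) = t * #F := by
        rw [sum_congr rfl fun S _ => hdegr S]
        simp [mul_comm]
      rw [ncard_edgeSet, ← hsum]
      apply le_of_eq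
      congr!

/-- Removing the vertices of `I` from a configuration leaves a maximal system. -/
theorem Conf.exists_isMaxRTSystem {k t : ℕ} (hk : 1 ≤ k) {V : Type} [Fintype V]
    {G : SimpleGraph V} {W I : Finset V} (h : Conf k t G W I) :
    ∃ (m : ℕ) (H : SimpleGraph (Fin m)) (F : Finset (Finset (Fin m))),
      IsMaxRTSystem (k + 2) t H F ∧ #F = #I ∧ H.edgeSet.ncard + t * #I ≤ #G.edgeFinset := by
  let m := #(W \ I)
  let e : Fin m ↪ V := (W \ I).equivFin.symm.toEmbedding.trans (Function.Embedding.subtype _)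
  have he : ∀ i, e i ∈ W ∧ e i ∉ I := fun i =>
    mem_sdiff.1 ((W \ I).equivFin.symm i).2
  have he' : ∀ x ∈ W, x ∉ I → ∃ i, e i = x := fun x hx hx' =>
    ⟨(W \ I).equivFin ⟨x, mem_sdiff.2 ⟨hx, hx'⟩⟩, by simp [e]⟩
  have hlift : ∀ c : Finset V, (∀ x ∈ c, x ∈ W ∧ x ∉ I) → ∃ c' : Finset (Fin m), c'.map e = c := by
    intro c hc
    refine ⟨univ.filter fun i => e i ∈ c, ?_⟩
    ext x
    simp only [mem_map, mem_filter, mem_univ, true_and]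
    constructor
    · rintro ⟨i, hi, rfl⟩; exact hi
    · intro hx
      obtain ⟨i, rfl⟩ := he' x (hc x hx).1 (hc x hx).2
      exact ⟨i, hx, rfl⟩
  have hWI : ∀ v ∈ I, ∀ x, G.Adj v x → x ∈ W ∧ x ∉ I := fun v hv x hx =>
    ⟨h.supp _ _ hx.symm, fun hxI => h.indep v hv x hxI hx⟩
  let H : SimpleGraph (Fin m) := G.comap e
  have hcl : ∀ n (c : Finset (Fin m)), G.IsNClique n (c.map e) ↔ H.IsNClique n c := by
    intro n c
    rw [isNClique_iff, isNClique_iff, card_map]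
    refine and_congr_left fun _ => ⟨fun hc x hx y hy hxy => ?_, fun hc x hx y hy hxy => ?_⟩
    · exact hc (mem_coe.2 (mem_map_of_mem e hx)) (mem_coe.2 (mem_map_of_mem e hy))
        (fun h => hxy (e.injective h))
    · simp only [coe_map, Set.mem_image, mem_coe] at hx hy
      obtain ⟨x, hx, rfl⟩ := hx
      obtain ⟨y, hy, rfl⟩ := hy
      exact hc hx hy (by rintro rfl; exact hxy rfl)
  let S : V → Finset (Fin m) := fun v => univ.filter fun i => G.Adj v (e i)
  have hS : ∀ v i, i ∈ S v ↔ G.Adj v (e i) := by simp [S]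
  have hSmap : ∀ v ∈ I, (S v).map e = G.neighborFinset v := by
    intro v hv
    ext x
    simp only [mem_map, hS, mem_neighborFinset]
    constructor
    · rintro ⟨i, hi, rfl⟩; exact hi
    · intro hx
      obtain ⟨i, rfl⟩ := he' x (hWI v hv x hx).1 (hWI v hv x hx).2
      exact ⟨i, hx, rfl⟩
  have hSinj : Set.InjOn S I := by
    intro u hu v hv huv
    refine h.inj u hu v hv fun x => ?_
    rw [← mem_neighborFinset, ← mem_neighborFinset, ← hSmap u hu, ← hSmap v hv, huv]
  refine ⟨m, H, I.image S, ⟨⟨?_, ?_, ?_⟩, ?_⟩, card_image_of_injOn hSinj, ?_⟩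
  · intro c hc
    exact h.free _ ((hcl _ _).2 hc)
  · intro T hT
    obtain ⟨v, hv, rfl⟩ := mem_image.1 hT
    refine ⟨?_, ?_, ?_⟩
    · rw [← card_map e, hSmap v hv, card_neighborFinset_eq_degree, h.deg v hv]
    · by_contra hcon
      obtain ⟨c, hcS, hc⟩ := not_cliqueFree_induce_iff.1 hcon
      refine h.free (insert v (c.map e)) (((hcl _ _).2 hc).insert fun b hb => ?_)
      obtain ⟨b, hbd, rfl⟩ := mem_map.1 hb
      exact (hS _ _).1 (hcS hbd)
    · intro x hx
      rw [hS] at hx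
      obtain ⟨d, hd, hd'⟩ := h.sat v (h.sub hv) (e x) (he x).1
        (by rintro rfl; exact (he x).2 hv) hx
      obtain ⟨d, rfl⟩ := hlift d fun y hy => hWI v hv y (hd' y hy).1
      rw [not_cliqueFree_induce_iff]
      refine ⟨insert x d, ?_, ((hcl _ _).1 hd).insert fun b hb => (hd' _ (mem_map_of_mem e hb)).2⟩
      rw [coe_subset]
      refine insert_subset_insert _ fun y hy => (hS _ _).2 (hd' _ (mem_map_of_mem e hy)).1
  · intro T hT T' hT' hne
    obtain ⟨v, hv, rfl⟩ := mem_image.1 hT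
    obtain ⟨w, hw, rfl⟩ := mem_image.1 hT'
    obtain ⟨d, hd, hd'⟩ := h.sat v (h.sub hv) w (h.sub hw) (by rintro rfl; exact hne rfl)
      (h.indep v hv w hw)
    obtain ⟨d, rfl⟩ := hlift d fun y hy => hWI v hv y (hd' y hy).1
    rw [not_cliqueFree_induce_iff]
    refine ⟨d, fun x hx => ?_, (hcl _ _).1 hd⟩
    have := hd' _ (mem_map_of_mem e hx)
    rw [mem_coe, mem_inter, hS, hS]
    exact this
  · intro u v huv hadj
    obtain ⟨d, hd, hd'⟩ := h.sat (e u) (he u).1 (e v) (he v).1 (fun h => huv (e.injective h)) hadj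
    by_cases hdI : ∀ x ∈ d, x ∉ I
    · left
      obtain ⟨d, rfl⟩ := hlift d fun y hy => ⟨h.supp _ _ (hd' y hy).1.symm, hdI y hy⟩
      obtain ⟨c, hc, -⟩ := exists_isNClique_sup_edge huv ((hcl _ _).1 hd)
        fun x hx => hd' _ (mem_map_of_mem e hx)
      exact hc.not_cliqueFree
    · right
      push Not at hdI
      obtain ⟨y, hyd, hyI⟩ := hdI
      have hy : ∀ x ∈ d.erase y, G.Adj y x := fun x hx =>
        hd.1 hyd (mem_of_mem_erase hx) (Ne.symm (ne_of_mem_erase hx))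
      obtain ⟨j, rfl⟩ : ∃ j, k = j + 1 := ⟨k - 1, by omega⟩
      have hd2 := hd.erase_of_mem hyd
      obtain ⟨d', hde⟩ := hlift (d.erase y) fun x hx => hWI y hyI x (hy x hx)
      rw [← hde] at hd2 hy
      refine ⟨S y, mem_image_of_mem _ hyI, ?_⟩
      obtain ⟨c, hc, hcd⟩ := exists_isNClique_sup_edge huv ((hcl _ _).1 hd2) fun x hx => by
        have := mem_map_of_mem e hx
        rw [hde] at this
        exact hd' _ (mem_of_mem_erase this)
      rw [not_cliqueFree_induce_iff]
      refine ⟨c, fun x hx => ?_, hc⟩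
      rw [mem_coe, hS]
      rcases hcd x hx with rfl | rfl | hx
      · exact (hd' y hyd).1.symm
      · exact (hd' y hyd).2.symm
      · exact hy _ (mem_map_of_mem e hx)
  · have := card_edgeFinset_add_sum_degree_le G (H.map e) I ?_ ?_ h.indep
    · rw [card_edgeFinset_map_embedding, sum_congr rfl h.deg] at this
      rw [sum_const, smul_eq_mul, mul_comm] at this
      rw [ncard_edgeSet]
      convert this
    · rw [map_le_iff_le_comap]
    · intro x hx y
      rw [map_adj]
      rintro ⟨a, b, -, rfl, -⟩
      exact (he a).2 hx

end

section

open Finset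
open scoped Classical

theorem Conf.ePrime_add_le {k t : ℕ} (hk : 1 ≤ k) {V : Type} [Fintype V]
    {G : SimpleGraph V} {W I : Finset V} (h : Conf k t G W I) :
    ePrime (k + 2) t #I + t * #I ≤ #G.edgeFinset := by
  obtain ⟨m, H, F, hs, hF, hle⟩ := h.exists_isMaxRTSystem hk
  have : ePrime (k + 2) t #I ≤ H.edgeSet.ncard := Nat.sInf_le ⟨m, H, F, hs, hF, rfl⟩
  omega

theorem _root_.SimpleGraph.exists_adj_iff_notMem {V : Type} (G : SimpleGraph V) (X : Finset V) :
    ∃ G₀ : SimpleGraph V, ∀ x y, G₀.Adj x y ↔ G.Adj x y ∧ x ∉ X ∧ y ∉ X :=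
  ⟨{ Adj := fun x y => G.Adj x y ∧ x ∉ X ∧ y ∉ X
     symm := ⟨fun _ _ h => ⟨h.1.symm, h.2.2, h.2.1⟩⟩
     loopless := ⟨fun x h => G.loopless.irrefl x h.1⟩ }, fun _ _ => Iff.rfl⟩

/-- Every vertex outside `I` and outside the neighbourhood of a fixed `v ∈ I` sends an edge to this
neighbourhood. -/
theorem Conf.card_sdiff_add_le {k t : ℕ} (hk : 1 ≤ k) {V : Type} [Fintype V]
    {G : SimpleGraph V} {W I : Finset V} (h : Conf k t G W I) (hI : I.Nonempty) :
    #(W \ I) + t * #I ≤ #G.edgeFinset + t := by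
  obtain ⟨v, hv⟩ := hI
  obtain ⟨G₀, hG₀'⟩ := G.exists_adj_iff_notMem I
  have h1 := card_edgeFinset_add_sum_degree_le G G₀ I (fun x y h => ((hG₀' _ _).1 h).1)
    (fun x hx y hxy => ((hG₀' _ _).1 hxy).2.1 hx) h.indep
  rw [sum_congr rfl h.deg, sum_const, smul_eq_mul] at h1
  have h2 : ∀ x ∈ (W \ I) \ G.neighborFinset v, ∃ y, G.Adj v y ∧ G₀.Adj x y := by
    intro x hx
    rw [mem_sdiff, mem_sdiff, mem_neighborFinset] at hx
    obtain ⟨⟨hxW, hxI⟩, hvx⟩ := hx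
    obtain ⟨d, hd, hd'⟩ := h.sat v (h.sub hv) x hxW (by rintro rfl; exact hxI hv) hvx
    obtain ⟨y, hy⟩ : d.Nonempty := by rw [← card_pos, hd.2]; omega
    refine ⟨y, (hd' y hy).1, (hG₀' _ _).2 ⟨(hd' y hy).2, hxI, fun hyI => h.indep v hv y hyI (hd' y hy).1⟩⟩
  choose! f hf hf' using h2
  have h3 : #((W \ I) \ G.neighborFinset v) ≤ #G₀.edgeFinset := by
    refine card_le_card_of_injOn (fun x => s(x, f x)) (fun x hx => ?_) ?_
    · simpa using hf' x hx
    · intro x hx y hy hxy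
      simp only [Sym2.eq_iff] at hxy
      rcases hxy with hxy | hxy
      · exact hxy.1
      · exfalso
        have := hf y hy
        rw [← hxy.1] at this
        rw [mem_coe, mem_sdiff, mem_neighborFinset] at hx
        exact hx.2 this
  have h4 := le_card_sdiff (G.neighborFinset v) (W \ I)
  rw [card_neighborFinset_eq_degree, h.deg v hv] at h4
  rw [mul_comm] at h1
  omega

theorem Conf.card_le_two_pow {k t : ℕ} {V : Type} [Fintype V]
    {G : SimpleGraph V} {W I : Finset V} (h : Conf k t G W I) :
    #I ≤ 2 ^ #(W \ I) := by
  rw [← card_powerset]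
  refine card_le_card_of_injOn (fun v => G.neighborFinset v) (fun v hv => ?_) fun u hu v hv huv => ?_
  · simp only [coe_powerset, Set.mem_preimage, Set.mem_powerset_iff, coe_subset]
    intro x hx
    rw [mem_neighborFinset] at hx
    exact mem_sdiff.2 ⟨h.supp _ _ hx.symm, fun hxI => h.indep v hv x hxI hx⟩
  · refine h.inj u hu v hv fun x => ?_
    have := congrArg (x ∈ ·) huv
    simpa using this

/-- Some configuration has exactly `s` distinguished vertices. -/
def HasConf (k t s : ℕ) : Prop :=
  ∃ (V : Type) (_ : Fintype V) (G : SimpleGraph V) (W I : Finset V), Conf k t G W I ∧ #I = s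

/-- The minimum in the definition of `ePrime` is attained, and yields a configuration. -/
theorem HasConf.exists_conf {k t s : ℕ} (hk : 1 ≤ k) (h : HasConf k t s) :
    ∃ (V : Type) (_ : Fintype V) (G : SimpleGraph V) (I : Finset V), Conf k t G univ I ∧
      #I = s ∧ #G.edgeFinset ≤ ePrime (k + 2) t s + t * s := by
  obtain ⟨V, _, G, W, I, hc, rfl⟩ := h
  obtain ⟨m, H, F, hs, hF, -⟩ := hc.exists_isMaxRTSystem hk
  obtain ⟨m', H', F', hs', hF', he⟩ :=
    Nat.sInf_mem (s := {e : ℕ | ∃ (m : ℕ) (H : SimpleGraph (Fin m)) (F : Finset (Finset (Fin m))),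
      IsMaxRTSystem (k + 2) t H F ∧ F.card = #I ∧ H.edgeSet.ncard = e}) ⟨_, m, H, F, hs, hF, rfl⟩
  obtain ⟨V', _, G', I', hc', hI', -, hle⟩ := exists_conf_of_isMaxRTSystem hk hs'
  refine ⟨V', _, G', I', hc', by omega, ?_⟩
  rw [he, hF'] at hle
  exact hle

theorem HasConf.le_two_pow {k t s : ℕ} (hk : 1 ≤ k) (h : HasConf k t s) :
    s ≤ 2 ^ (ePrime (k + 2) t s + t) := by
  obtain ⟨V, _, G, I, hc, rfl, he⟩ := h.exists_conf hk
  rcases I.eq_empty_or_nonempty with rfl | hI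
  · simp
  · refine hc.card_le_two_pow.trans (Nat.pow_le_pow_right (by norm_num) ?_)
    have := hc.card_sdiff_add_le hk hI
    omega

/-- Removing a vertex set from a saturated graph, and resaturating among the pairs that had a common
neighbour in the removed set. -/
theorem SatOn.exists_removeSet {k : ℕ} {V : Type} [Fintype V] {G : SimpleGraph V}
    {W : Finset V} (h : SatOn k G W) (X : Finset V) :
    ∃ G' : SimpleGraph V, SatOn k G' (W \ X) ∧
      (∀ x y, G'.Adj x y → x ∉ X ∧ y ∉ X ∧ (G.Adj x y ∨ ∃ v ∈ X, G.Adj v x ∧ G.Adj v y)) ∧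
      (∀ x y, x ∉ X → y ∉ X → G.Adj x y → G'.Adj x y) ∧
      ∀ J ⊆ X, (∀ x ∈ J, ∀ y ∈ J, ¬ G.Adj x y) →
        #G'.edgeFinset + ∑ v ∈ J, G.degree v ≤ #G.edgeFinset + ∑ v ∈ X, G.degree v ^ 2 := by
  obtain ⟨G₀, hG₀'⟩ := G.exists_adj_iff_notMem X
  let U : SimpleGraph V :=
    { Adj := fun x y => x ≠ y ∧ x ∉ X ∧ y ∉ X ∧ (G.Adj x y ∨ ∃ v ∈ X, G.Adj v x ∧ G.Adj v y)
      symm := ⟨fun x y h => ⟨h.1.symm, h.2.2.1, h.2.1, h.2.2.2.imp (fun h => h.symm)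
        fun ⟨v, hv, h⟩ => ⟨v, hv, h.symm⟩⟩⟩
      loopless := ⟨fun x h => h.1 rfl⟩ }
  obtain ⟨G', hG₀, hmax⟩ := Set.Finite.exists_le_maximal
    (s := {K : SimpleGraph V | K.CliqueFree (k + 2) ∧ K ≤ U}) (Set.toFinite _) (a := G₀)
    ⟨h.free.anti fun x y h => ((hG₀' _ _).1 h).1, fun x y hxy => by
      have h := (hG₀' _ _).1 hxy
      exact ⟨h.1.ne, h.2.1, h.2.2, Or.inl h.1⟩⟩
  obtain ⟨⟨hfree, hU⟩, hmax⟩ := hmax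
  have hkeep : ∀ x y, x ∉ X → y ∉ X → G.Adj x y → G'.Adj x y :=
    fun x y hx hy hxy => hG₀ ((hG₀' _ _).2 ⟨hxy, hx, hy⟩)
  refine ⟨G', ⟨?_, hfree, ?_⟩, fun x y hxy => (hU hxy).2, hkeep, ?_⟩
  · intro u v huv
    obtain ⟨-, hu, hv, h1 | ⟨w, -, hw, -⟩⟩ := hU huv
    · exact mem_sdiff.2 ⟨h.supp _ _ h1, hu⟩
    · exact mem_sdiff.2 ⟨h.supp _ _ hw.symm, hu⟩
  · intro u hu v hv huv hadj
    rw [mem_sdiff] at hu hv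
    obtain ⟨d, hd, hd'⟩ := h.sat u hu.1 v hv.1 huv fun h => hadj (hkeep _ _ hu.2 hv.2 h)
    by_cases hdX : ∀ x ∈ d, x ∉ X
    · exact ⟨d, ⟨fun x hx y hy hxy => hkeep _ _ (hdX x hx) (hdX y hy) (hd.1 hx hy hxy), hd.2⟩,
        fun x hx => ⟨hkeep _ _ hu.2 (hdX x hx) (hd' x hx).1,
          hkeep _ _ hv.2 (hdX x hx) (hd' x hx).2⟩⟩
    · push Not at hdX
      obtain ⟨w, hwd, hwX⟩ := hdX
      have hUuv : U.Adj u v :=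
        ⟨huv, hu.2, hv.2, Or.inr ⟨w, hwX, (hd' w hwd).1.symm, (hd' w hwd).2.symm⟩⟩
      have hle : G' ⊔ fromEdgeSet {s(u, v)} ≤ U := by
        refine sup_le hU fun x y hxy => ?_
        rw [fromEdgeSet_adj, Set.mem_singleton_iff, Sym2.eq_iff] at hxy
        rcases hxy.1 with ⟨rfl, rfl⟩ | ⟨rfl, rfl⟩
        · exact hUuv
        · exact hUuv.symm
      have hnot : ¬ (G' ⊔ fromEdgeSet {s(u, v)}).CliqueFree (k + 2) := by
        intro hcf
        refine hadj (hmax (y := G' ⊔ fromEdgeSet {s(u, v)}) ⟨hcf, hle⟩ le_sup_left ?_)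
        exact Or.inr (by simp [huv])
      obtain ⟨c, hc⟩ := not_cliqueFree_iff_exists.1 hnot
      obtain ⟨-, -, d, -, hd⟩ := isNClique_erase_of_sup_edge huv hc (hfree c)
      exact ⟨d, hd⟩
  · intro J hJX hJ
    have h1 := card_edgeFinset_add_sum_degree_le G G₀ J (fun x y h => ((hG₀' _ _).1 h).1)
      (fun x hx y hxy => ((hG₀' _ _).1 hxy).2.1 (hJX hx)) hJ
    have hsub : G'.edgeFinset ⊆ G₀.edgeFinset ∪
        X.biUnion fun v => (G.neighborFinset v ×ˢ G.neighborFinset v).image fun p => s(p.1, p.2) := by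
      intro e he
      induction e with
      | h x y =>
        rw [mem_edgeFinset, mem_edgeSet] at he
        obtain ⟨-, hx, hy, h1 | ⟨w, hw, hwx, hwy⟩⟩ := hU he
        · exact mem_union_left _ (mem_edgeFinset.2 ((hG₀' _ _).2 ⟨h1, hx, hy⟩))
        · refine mem_union_right _ (mem_biUnion.2 ⟨w, hw, mem_image.2 ⟨(x, y), ?_, rfl⟩⟩)
          simp [hwx, hwy]
    have h2 : #G'.edgeFinset ≤ #G₀.edgeFinset + ∑ v ∈ X, G.degree v ^ 2 := by
      refine (card_le_card hsub).trans ((card_union_le _ _).trans ?_)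
      gcongr
      refine card_biUnion_le.trans (sum_le_sum fun v _ => card_image_le.trans ?_)
      rw [card_product, card_neighborFinset_eq_degree, sq]
    omega

/-- If the removed set has no neighbour among the remaining distinguished vertices, the result is
again a configuration. -/
theorem Conf.of_removeSet {k t : ℕ} {V : Type} [Fintype V] {G G' : SimpleGraph V}
    {W I X : Finset V} (h : Conf k t G W I) (h' : SatOn k G' (W \ X))
    (hup : ∀ x y, G'.Adj x y → x ∉ X ∧ y ∉ X ∧ (G.Adj x y ∨ ∃ v ∈ X, G.Adj v x ∧ G.Adj v y))
    (hkeep : ∀ x y, x ∉ X → y ∉ X → G.Adj x y → G'.Adj x y)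
    (hX : ∀ x ∈ X, ∀ y ∈ I \ X, ¬ G.Adj x y) :
    Conf k t G' (W \ X) (I \ X) ∧ ∀ y ∈ I \ X, ∀ x, G'.Adj y x ↔ G.Adj y x := by
  have hnb : ∀ y ∈ I \ X, ∀ x, G'.Adj y x ↔ G.Adj y x := by
    intro y hy x
    constructor
    · intro hyx
      obtain ⟨-, -, h1 | ⟨v, hv, h1, -⟩⟩ := hup y x hyx
      · exact h1
      · exact absurd h1 (hX v hv y hy)
    · intro hyx
      exact hkeep _ _ (mem_sdiff.1 hy).2 (fun hx => hX x hx y hy hyx.symm) hyx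
  refine ⟨⟨h', sdiff_subset_sdiff h.sub le_rfl, ?_, ?_, ?_⟩, hnb⟩
  · intro u hu v hv
    rw [hnb u hu]
    exact h.indep u (mem_sdiff.1 hu).1 v (mem_sdiff.1 hv).1
  · intro u hu
    rw [← h.deg u (mem_sdiff.1 hu).1, ← card_neighborFinset_eq_degree,
      ← card_neighborFinset_eq_degree]
    congr 1
    ext x
    rw [mem_neighborFinset, mem_neighborFinset, hnb u hu]
  · intro u hu v hv huv
    refine h.inj u (mem_sdiff.1 hu).1 v (mem_sdiff.1 hv).1 fun x => ?_
    rw [← hnb u hu, ← hnb v hv, huv]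

/-- Removing distinguished vertices. -/
theorem Conf.exists_removeSet {k t : ℕ} {V : Type} [Fintype V] {G : SimpleGraph V}
    {W I X : Finset V} (h : Conf k t G W I) (hX : X ⊆ I) :
    ∃ G' : SimpleGraph V, Conf k t G' (W \ X) (I \ X) ∧
      (∀ y ∈ I \ X, ∀ x, G'.Adj y x ↔ G.Adj y x) ∧
      (∀ x y, G'.Adj x y → x ∉ X ∧ y ∉ X ∧ (G.Adj x y ∨ ∃ v ∈ X, G.Adj v x ∧ G.Adj v y)) ∧
      (∀ x y, x ∉ X → y ∉ X → G.Adj x y → G'.Adj x y) ∧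
      #G'.edgeFinset + t * #X ≤ #G.edgeFinset + t ^ 2 * #X := by
  obtain ⟨G', h', hup, hkeep, hcard⟩ := h.toSatOn.exists_removeSet X
  have hc := h.of_removeSet h' hup hkeep
    fun x hx y hy => h.indep x (hX hx) y (mem_sdiff.1 hy).1
  refine ⟨G', hc.1, hc.2, hup, hkeep, ?_⟩
  have := hcard X le_rfl fun x hx y hy => h.indep x (hX hx) y (hX hy)
  rw [sum_congr rfl fun x hx => h.deg x (hX hx),
    sum_congr rfl fun x hx => congrArg (· ^ 2) (h.deg x (hX hx)), sum_const, sum_const] at this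
  simpa [mul_comm] using this

theorem HasConf.ePrime_le {k t s j : ℕ} (hk : 1 ≤ k) (h : HasConf k t (s + j)) :
    HasConf k t s ∧ ePrime (k + 2) t s ≤ ePrime (k + 2) t (s + j) + t ^ 2 * j := by
  obtain ⟨V, _, G, I, hc, hI, he⟩ := h.exists_conf hk
  obtain ⟨X, hX, hXc⟩ := exists_subset_card_eq (s := I) (n := j) (by omega)
  obtain ⟨G', hc', -, -, -, hcard⟩ := hc.exists_removeSet hX
  have hs : #(I \ X) = s := by rw [card_sdiff_of_subset hX]; omega
  refine ⟨⟨V, _, G', _, _, hc', hs⟩, ?_⟩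
  have := hc'.ePrime_add_le hk
  rw [hs] at this
  rw [hXc] at hcard
  have : t * (s + j) = t * s + t * j := by ring
  omega

end

section

open Finset
open scoped Classical

/-- A configuration with `s` distinguished vertices, at most `a` other vertices, and at most `b`
edges between the latter. -/
def HasBoundedConf (k t s a b : ℕ) : Prop :=
  ∃ (V : Type) (_ : Fintype V) (G : SimpleGraph V) (I : Finset V), Conf k t G univ I ∧
    #I = s ∧ #(univ \ I) ≤ a ∧ #G.edgeFinset ≤ t * s + b

/-- The vertices of an explicit saturated graph with few edges outside the distinguished vertices,
which are those of the form `I a i j`. -/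
inductive BlockVertex (x p b : ℕ) : Type
  | X (i : Fin x)
  | A (e : Bool) (a : Fin p)
  | C (i j : Fin b)
  | D (e : Bool) (l : Fin b)
  | I (a : Fin p) (i j : Fin b)

namespace BlockVertex

variable {x p b : ℕ}

def Adj : BlockVertex x p b → BlockVertex x p b → Prop
  | X _, I _ _ _ => True
  | I _ _ _, X _ => True
  | A e a, A e' a' => e ≠ e' ∧ a ≠ a'
  | A _ a, I a' _ _ => a = a'
  | I a' _ _, A _ a => a = a'
  | C i j, D e l => l ≠ cond e i j
  | D e l, C i j => l ≠ cond e i j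
  | C i j, I _ i' j' => i = i' ∧ j = j'
  | I _ i' j', C i j => i = i' ∧ j = j'
  | D e l, I _ i j => l = cond e i j
  | I _ i j, D e l => l = cond e i j
  | _, _ => False

theorem Adj.symm {u v : BlockVertex x p b} (h : Adj u v) : Adj v u := by
  cases u <;> cases v <;> simp_all [Adj, eq_comm]

theorem not_adj_self (u : BlockVertex x p b) : ¬ Adj u u := by
  cases u <;> simp [Adj]

noncomputable instance : Fintype (BlockVertex x p b) :=
  Fintype.ofSurjective
    (fun v : Fin x ⊕ (Bool × Fin p) ⊕ (Fin b × Fin b) ⊕ (Bool × Fin b) ⊕ (Fin p × Fin b × Fin b) =>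
      match v with
      | .inl i => X i
      | .inr (.inl v) => A v.1 v.2
      | .inr (.inr (.inl v)) => C v.1 v.2
      | .inr (.inr (.inr (.inl v))) => D v.1 v.2
      | .inr (.inr (.inr (.inr v))) => I v.1 v.2.1 v.2.2) (by
    rintro (i | ⟨e, a⟩ | ⟨i, j⟩ | ⟨e, l⟩ | ⟨a, i, j⟩)
    · exact ⟨.inl i, rfl⟩
    · exact ⟨.inr (.inl (e, a)), rfl⟩
    · exact ⟨.inr (.inr (.inl (i, j))), rfl⟩
    · exact ⟨.inr (.inr (.inr (.inl (e, l)))), rfl⟩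
    · exact ⟨.inr (.inr (.inr (.inr (a, i, j)))), rfl⟩)

theorem exists_ne_ne {n : ℕ} (hn : 3 ≤ n) (i j : Fin n) : ∃ l, l ≠ i ∧ l ≠ j := by
  obtain ⟨l, hl⟩ := exists_mem_notMem_of_card_lt_card (s := ({i, j} : Finset (Fin n)))
    (t := univ) (lt_of_le_of_lt card_le_two (by simpa [Nat.lt_iff_add_one_le] using hn))
  exact ⟨l, by simpa using hl.2⟩

theorem exists_common (hx : 1 ≤ x) (hp : 3 ≤ p) (hb : 3 ≤ b) {u v : BlockVertex x p b}
    (huv : u ≠ v) (hadj : ¬ Adj u v) : ∃ w, Adj u w ∧ Adj v w := by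
  let x₀ : Fin x := ⟨0, hx⟩
  let a₀ : Fin p := ⟨0, by omega⟩
  let i₀ : Fin b := ⟨0, by omega⟩
  have hAI : ∀ (e : Bool) (a a' : Fin p) (i j : Fin b), a ≠ a' →
      ∃ w, Adj (A e a : BlockVertex x p b) w ∧ Adj (I a' i j) w := by
    intro e a a' i j h
    exact ⟨A (!e) a', by simp [Adj, h]⟩
  have hCI : ∀ (a : Fin p) (i j i' j' : Fin b), ¬ (i = i' ∧ j = j') →
      ∃ w, Adj (C i j : BlockVertex x p b) w ∧ Adj (I a i' j') w := by
    intro a i j i' j' h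
    by_cases hi : i' = i
    · exact ⟨D false j', by simp [Adj]; tauto⟩
    · exact ⟨D true i', by simp [Adj, hi]⟩
  have hDI : ∀ (e : Bool) (a : Fin p) (i j l : Fin b), l ≠ cond e i j →
      ∃ w, Adj (D e l : BlockVertex x p b) w ∧ Adj (I a i j) w := by
    intro e a i j l h
    exact ⟨C i j, by simp [Adj, h]⟩
  have hCD : ∀ (e : Bool) (i j l : Fin b), l = cond e i j →
      ∃ w, Adj (C i j : BlockVertex x p b) w ∧ Adj (D e l) w := by
    intro e i j l h
    exact ⟨I a₀ i j, by simp [Adj, h]⟩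
  have hAD : ∀ (e e' : Bool) (a : Fin p) (l : Fin b),
      ∃ w, Adj (A e a : BlockVertex x p b) w ∧ Adj (D e' l) w := by
    intro e e' a l
    exact ⟨I a l l, by cases e' <;> simp [Adj]⟩
  have hAC : ∀ (e : Bool) (a : Fin p) (i j : Fin b),
      ∃ w, Adj (A e a : BlockVertex x p b) w ∧ Adj (C i j) w := by
    intro e a i j
    exact ⟨I a i j, by simp [Adj]⟩
  have hX : ∀ (i : Fin x) (v : BlockVertex x p b), ¬ Adj (X i) v →
      ∃ w, Adj (X i) w ∧ Adj v w := by
    intro i v hv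
    rcases v with i' | ⟨e, a⟩ | ⟨i', j⟩ | ⟨e, l⟩ | ⟨a, i', j⟩
    · exact ⟨I a₀ i₀ i₀, by simp [Adj]⟩
    · exact ⟨I a i₀ i₀, by simp [Adj]⟩
    · exact ⟨I a₀ i' j, by simp [Adj]⟩
    · exact ⟨I a₀ l l, by cases e <;> simp [Adj]⟩
    · simp [Adj] at hv
  have hcomm : ∀ {u v : BlockVertex x p b}, (∃ w, Adj u w ∧ Adj v w) → ∃ w, Adj v w ∧ Adj u w :=
    fun ⟨w, h⟩ => ⟨w, h.symm⟩
  by_cases hvX : ∃ i, v = X i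
  · obtain ⟨i, rfl⟩ := hvX
    exact hcomm (hX i u fun h => hadj h.symm)
  rcases u with i | ⟨e, a⟩ | ⟨i, j⟩ | ⟨e, l⟩ | ⟨a, i, j⟩
  · exact hX i v hadj
  · rcases v with i' | ⟨e', a'⟩ | ⟨i', j'⟩ | ⟨e', l'⟩ | ⟨a', i', j'⟩
    · exact absurd ⟨_, rfl⟩ hvX
    · by_cases ha : a = a'
      · exact ⟨I a i₀ i₀, by simp [Adj, ha]⟩
      · have he : e = e' := by
          by_contra he
          exact hadj ⟨he, ha⟩
        obtain ⟨c, hc, hc'⟩ := exists_ne_ne hp a a'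
        exact ⟨A (!e) c, by simp [Adj, he, hc.symm, hc'.symm]⟩
    · exact hAC _ _ _ _
    · exact hAD _ _ _ _
    · exact hAI _ _ _ _ _ hadj
  · rcases v with i' | ⟨e', a'⟩ | ⟨i', j'⟩ | ⟨e', l'⟩ | ⟨a', i', j'⟩
    · exact absurd ⟨_, rfl⟩ hvX
    · exact hcomm (hAC _ _ _ _)
    · obtain ⟨c, hc, hc'⟩ := exists_ne_ne hb i i'
      exact ⟨D true c, by simp [Adj, hc, hc']⟩
    · exact hCD _ _ _ _ (not_not.1 hadj)
    · exact hCI _ _ _ _ _ hadj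
  · rcases v with i' | ⟨e', a'⟩ | ⟨i', j'⟩ | ⟨e', l'⟩ | ⟨a', i', j'⟩
    · exact absurd ⟨_, rfl⟩ hvX
    · exact hcomm (hAD _ _ _ _)
    · exact hcomm (hCD _ _ _ _ (not_not.1 hadj))
    · obtain ⟨c, hc, hc'⟩ := exists_ne_ne hb l l'
      exact ⟨C c c, by cases e <;> cases e' <;> simp [Adj, hc.symm, hc'.symm]⟩
    · exact hDI _ _ _ _ _ hadj
  · rcases v with i' | ⟨e', a'⟩ | ⟨i', j'⟩ | ⟨e', l'⟩ | ⟨a', i', j'⟩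
    · exact absurd ⟨_, rfl⟩ hvX
    · exact hcomm (hAI _ _ _ _ _ fun h => hadj h)
    · exact hcomm (hCI _ _ _ _ _ fun h => hadj h)
    · exact hcomm (hDI _ _ _ _ _ fun h => hadj h)
    · exact ⟨X x₀, by simp [Adj]⟩

theorem not_adj_of_adj_of_adj {u v w : BlockVertex x p b} (huv : Adj u v) (huw : Adj u w) :
    ¬ Adj v w := by
  rcases u with i | ⟨e, a⟩ | ⟨i, j⟩ | ⟨e, l⟩ | ⟨a, i, j⟩ <;>
  rcases v with i' | ⟨e', a'⟩ | ⟨i', j'⟩ | ⟨e', l'⟩ | ⟨a', i', j'⟩ <;>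
  simp only [Adj] at huv <;>
  rcases w with i'' | ⟨e'', a''⟩ | ⟨i'', j''⟩ | ⟨e'', l''⟩ | ⟨a'', i'', j''⟩ <;>
  simp only [Adj] at huw <;> simp only [Adj, not_false_iff] <;>
  first
  | grind
  | cases e <;> cases e' <;> cases e'' <;> simp_all

end BlockVertex

open BlockVertex in
theorem hasBoundedConf_one {x p b : ℕ} (hx : 1 ≤ x) (hp : 3 ≤ p) (hb : 3 ≤ b) :
    HasBoundedConf 1 (x + 5) (p * (b * b)) (x + 2 * p + b * b + 2 * b)
      (4 * p ^ 2 + 2 * b ^ 3) := by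
  obtain ⟨G, hG⟩ : ∃ G : SimpleGraph (BlockVertex x p b), ∀ u v, G.Adj u v ↔ BlockVertex.Adj u v :=
    ⟨{ Adj := BlockVertex.Adj, symm := ⟨fun _ _ h => h.symm⟩, loopless := ⟨not_adj_self⟩ }, fun _ _ => Iff.rfl⟩
  let J : Finset (BlockVertex x p b) :=
    univ.image fun v : Fin p × Fin b × Fin b => I v.1 v.2.1 v.2.2
  have hJ : ∀ v, v ∈ J ↔ ∃ a i j, v = I a i j := by
    intro v
    simp [J, eq_comm]
  have hJc : #J = p * (b * b) := by
    rw [card_image_of_injective]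
    · simp
    · rintro ⟨a, i, j⟩ ⟨a', i', j'⟩ h
      simpa using h
  have hdeg : ∀ u ∈ J, G.degree u = x + 5 := by
    intro u hu
    obtain ⟨a, i, j, rfl⟩ := (hJ u).1 hu
    have hN : G.neighborFinset (I a i j) =
        (univ : Finset (Fin x)).image X ∪ {A true a, A false a, C i j, D true i, D false j} := by
      ext v
      rw [mem_neighborFinset, hG]
      rcases v with i' | ⟨e', a'⟩ | ⟨i', j'⟩ | ⟨e', l'⟩ | ⟨a', i', j'⟩
      · simp [BlockVertex.Adj]
      · cases e' <;> simp [BlockVertex.Adj]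
      · simp [BlockVertex.Adj]
      · cases e' <;> simp [BlockVertex.Adj]
      · simp [BlockVertex.Adj]
    rw [← card_neighborFinset_eq_degree, hN, card_union_of_disjoint,
      card_image_of_injective _ (fun _ _ h => by simpa using h)]
    · simp
    · rw [Finset.disjoint_left]
      intro v hv
      obtain ⟨i, -, rfl⟩ := mem_image.1 hv
      simp
  have hsumdeg : ∑ v ∈ J, G.degree v = (x + 5) * (p * (b * b)) := by
    rw [sum_congr rfl hdeg, sum_const, hJc, smul_eq_mul, mul_comm]
  refine ⟨BlockVertex x p b, inferInstance, G, J, ⟨⟨fun _ _ _ => mem_univ _, ?_, ?_⟩,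
    subset_univ _, ?_, hdeg, ?_⟩, hJc, ?_, ?_⟩
  · intro c hc
    obtain ⟨u, v, w, huv, huw, hvw, rfl⟩ := is3Clique_iff.1 hc
    rw [hG] at huv huw hvw
    exact not_adj_of_adj_of_adj huv huw hvw
  · intro u _ v _ huv hadj
    rw [hG] at hadj
    obtain ⟨w, hw⟩ := exists_common hx hp hb huv hadj
    refine ⟨{w}, by simp [isNClique_iff], fun y hy => ?_⟩
    rw [mem_singleton] at hy
    rw [hy, hG, hG]
    exact hw
  · intro u hu v hv
    obtain ⟨a, i, j, rfl⟩ := (hJ u).1 hu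
    obtain ⟨a', i', j', rfl⟩ := (hJ v).1 hv
    simp [hG, BlockVertex.Adj]
  · intro u hu v hv huv
    obtain ⟨a, i, j, rfl⟩ := (hJ u).1 hu
    obtain ⟨a', i', j', rfl⟩ := (hJ v).1 hv
    have h1 := huv (A true a)
    have h2 := huv (C i j)
    simp only [hG, BlockVertex.Adj] at h1 h2
    simp only [true_iff, and_self] at h1 h2
    rw [h1, h2.1, h2.2]
  · have hsub : univ \ J ⊆ (univ : Finset (Fin x)).image X ∪
        (univ : Finset (Bool × Fin p)).image (fun v => A v.1 v.2) ∪
        (univ : Finset (Fin b × Fin b)).image (fun v => C v.1 v.2) ∪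
        (univ : Finset (Bool × Fin b)).image (fun v => D v.1 v.2) := by
      intro v hv
      rw [mem_sdiff, hJ] at hv
      rcases v with i' | ⟨e', a'⟩ | ⟨i', j'⟩ | ⟨e', l'⟩ | ⟨a', i', j'⟩
      · simp
      · simp
      · simp
      · simp
      · simp at hv
    refine (card_le_card hsub).trans ((card_union_le _ _).trans (add_le_add
      ((card_union_le _ _).trans (add_le_add
      ((card_union_le _ _).trans (add_le_add ?_ ?_)) ?_)) ?_))
    all_goals
      refine card_image_le.trans ?_
      simp
  · obtain ⟨G₀, hG₀⟩ := G.exists_adj_iff_notMem J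
    refine (card_edgeFinset_le_add_sum_degree G G₀ J
      fun u v h hu hv => (hG₀ u v).2 ⟨h, hu, hv⟩).trans ?_
    rw [hsumdeg, add_comm]
    refine Nat.add_le_add_left ?_ _
    have hsub : G₀.edgeFinset ⊆
        (univ : Finset ((Bool × Fin p) × (Bool × Fin p))).image
          (fun v => s(A v.1.1 v.1.2, A v.2.1 v.2.2)) ∪
        (univ : Finset ((Fin b × Fin b) × (Bool × Fin b))).image
          (fun v => s(C v.1.1 v.1.2, D v.2.1 v.2.2)) := by
      intro e he
      induction e with
      | h u v =>
        rw [mem_edgeFinset, mem_edgeSet, hG₀, hJ, hJ, hG] at he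
        obtain ⟨huv, hu, hv⟩ := he
        rcases u with i | ⟨e, a⟩ | ⟨i, j⟩ | ⟨e, l⟩ | ⟨a, i, j⟩ <;>
        rcases v with i' | ⟨e', a'⟩ | ⟨i', j'⟩ | ⟨e', l'⟩ | ⟨a', i', j'⟩ <;>
        simp only [BlockVertex.Adj] at huv <;>
        first
        | exact mem_union_left _ (mem_image.2 ⟨((e, a), (e', a')), mem_univ _, rfl⟩)
        | exact mem_union_right _ (mem_image.2 ⟨((i, j), (e', l')), mem_univ _, rfl⟩)
        | exact mem_union_right _ (mem_image.2 ⟨((i', j'), (e, l)), mem_univ _, Sym2.eq_swap⟩)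
        | simp at hu hv
    refine (card_le_card hsub).trans ((card_union_le _ _).trans ?_)
    refine add_le_add (card_image_le.trans (le_of_eq ?_)) (card_image_le.trans (le_of_eq ?_)) <;>
    · simp; ring

/-- Joining a new vertex to everything. -/
theorem HasBoundedConf.join {k t s a b : ℕ} (h : HasBoundedConf k t s a b) :
    HasBoundedConf (k + 1) (t + 1) s (a + 1) (b + a) := by
  obtain ⟨V, _, G, I, hc, hI, ha, hb⟩ := h
  let A : Option V → Option V → Prop
    | none, none => False
    | none, some _ => True
    | some _, none => True
    | some u, some v => G.Adj u v
  obtain ⟨K, hK⟩ : ∃ K : SimpleGraph (Option V), ∀ u v, K.Adj u v ↔ A u v :=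
    ⟨{ Adj := A
       symm := ⟨by
        rintro (_ | u) (_ | v) h
        · exact h
        · trivial
        · trivial
        · exact G.symm.symm _ _ h⟩
       loopless := ⟨by
        rintro (_ | u) h
        · exact h
        · exact G.loopless.irrefl _ h⟩ }, fun _ _ => Iff.rfl⟩
  have hss : ∀ u v, K.Adj (some u) (some v) ↔ G.Adj u v := fun u v => hK _ _
  have hns : ∀ v, K.Adj none (some v) := fun v => (hK _ _).2 trivial
  have hsn : ∀ v, K.Adj (some v) none := fun v => (hK _ _).2 trivial
  have hIc : #(I.map Function.Embedding.some) = s := by rw [card_map, hI]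
  have hdeg : ∀ u ∈ I.map Function.Embedding.some, K.degree u = t + 1 := by
    intro u hu
    obtain ⟨v, hv, rfl⟩ := mem_map.1 hu
    have hN : K.neighborFinset (some v) =
        insert none ((G.neighborFinset v).map Function.Embedding.some) := by
      ext y
      rcases y with _ | y
      · simp [hsn]
      · simp [hss]
    have := hc.deg v hv
    rw [← card_neighborFinset_eq_degree] at this ⊢
    change #(K.neighborFinset (some v)) = t + 1
    rw [hN, card_insert_of_notMem (by simp), card_map, this]
  refine ⟨Option V, inferInstance, K, I.map Function.Embedding.some,
    ⟨⟨fun _ _ _ => mem_univ _, ?_, ?_⟩, subset_univ _, ?_, hdeg, ?_⟩, hIc, ?_, ?_⟩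
  · intro c hcl
    have h1 : G.IsClique c.eraseNone := by
      intro u hu v hv huv
      rw [mem_coe, mem_eraseNone] at hu hv
      exact (hss _ _).1 (hcl.1 hu hv (by simpa using huv))
    have h2 : k + 2 ≤ #c.eraseNone := by
      have := hcl.2
      by_cases hnc : none ∈ c
      · rw [card_eraseNone_of_mem hnc]
        omega
      · rw [card_eraseNone_of_not_mem hnc]
        omega
    exact (hc.free.mono h2) _ ⟨h1, rfl⟩
  · rintro (_ | u) - (_ | v) - huv hadj
    · exact absurd rfl huv
    · exact absurd (hns v) hadj
    · exact absurd (hsn u) hadj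
    · rw [hss] at hadj
      obtain ⟨d, hd, hd'⟩ := hc.sat u (mem_univ _) v (mem_univ _) (by simpa using huv) hadj
      refine ⟨insert none (d.map Function.Embedding.some), IsNClique.insert ⟨?_, ?_⟩ ?_, ?_⟩
      · intro x hx y hy hxy
        simp only [coe_map, Set.mem_image, mem_coe] at hx hy
        obtain ⟨x, hx, rfl⟩ := hx
        obtain ⟨y, hy, rfl⟩ := hy
        exact (hss _ _).2 (hd.1 hx hy (by rintro rfl; exact hxy rfl))
      · rw [card_map, hd.2]
      · intro x hx
        obtain ⟨x, -, rfl⟩ := mem_map.1 hx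
        exact hns x
      · intro x hx
        rcases mem_insert.1 hx with rfl | hx
        · exact ⟨hsn _, hsn _⟩
        · obtain ⟨x, hxd, rfl⟩ := mem_map.1 hx
          exact ⟨(hss _ _).2 (hd' x hxd).1, (hss _ _).2 (hd' x hxd).2⟩
  · intro u hu v hv
    obtain ⟨u, hu', rfl⟩ := mem_map.1 hu
    obtain ⟨v, hv', rfl⟩ := mem_map.1 hv
    exact fun h => hc.indep u hu' v hv' ((hss _ _).1 h)
  · intro u hu v hv huv
    obtain ⟨u, hu', rfl⟩ := mem_map.1 hu
    obtain ⟨v, hv', rfl⟩ := mem_map.1 hv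
    congr 1
    exact hc.inj u hu' v hv' fun y => by simpa [hss] using huv (some y)
  · have h1 := card_univ_sdiff_eq I
    rw [card_univ_sdiff_eq, card_map, Fintype.card_option]
    omega
  · have h1 := card_edgeFinset_le_add_sum_degree K (G.map Function.Embedding.some) {none} ?_
    · rw [card_edgeFinset_map_embedding, sum_singleton] at h1
      have h2 := K.degree_lt_card_verts none
      have h3 := card_univ_sdiff_eq I
      rw [Fintype.card_option] at h2
      have h4 : (t + 1) * s = t * s + s := by ring
      rw [h4]
      have h5 : Fintype.card V ≤ a + s := by omega
      convert_to _ ≤ t * s + b + (a + s)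
      · ring
      · refine h1.trans (add_le_add ?_ ?_)
        · convert hb
        · omega
    · rintro (_ | u) (_ | v) h hu hv
      · simp at hu
      · simp at hu
      · simp at hv
      · rw [map_adj]
        exact ⟨u, v, (hss _ _).1 h, rfl, rfl⟩

theorem HasBoundedConf.join_iterate {t s a b : ℕ} (h : HasBoundedConf 1 t s a b) (i : ℕ) :
    HasBoundedConf (1 + i) (t + i) s (a + i) (b + i * (a + i)) := by
  induction i with
  | zero => simpa using h
  | succ i ih =>
    obtain ⟨V, _, G, I, hc, hI, ha, hb⟩ := ih.join
    refine ⟨V, _, G, I, hc, hI, ha, hb.trans ?_⟩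
    have : b + i * (a + i) + (a + i) ≤ b + (i + 1) * (a + (i + 1)) := by nlinarith
    have h2 : t + i + 1 = t + (i + 1) := by ring
    rw [h2]
    omega

theorem HasBoundedConf.hasConf {k t s a b : ℕ} (h : HasBoundedConf k t s a b) :
    HasConf k t s := by
  obtain ⟨V, _, G, I, hc, hI, -⟩ := h
  exact ⟨V, _, G, _, I, hc, hI⟩

theorem HasBoundedConf.ePrime_le {k t s a b : ℕ} (hk : 1 ≤ k) (h : HasBoundedConf k t s a b) :
    ePrime (k + 2) t s ≤ b := by
  obtain ⟨V, _, G, I, hc, rfl, -, hb⟩ := h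
  have := hc.ePrime_add_le hk
  omega

theorem exists_ePrime_pow_le {k t : ℕ} (hk : 1 ≤ k) (ht : k + 5 ≤ t) :
    ∃ C : ℕ, ∀ q, 3 ≤ q → HasConf k t (q ^ 7) ∧ ePrime (k + 2) t (q ^ 7) ≤ C * q ^ 6 := by
  obtain ⟨i, rfl⟩ := Nat.exists_eq_add_of_le hk
  obtain ⟨x, rfl⟩ : ∃ x, t = (x + 1 + 5) + i := ⟨t - (6 + i), by omega⟩
  refine ⟨6 + i * (x + 6 + i), fun q hq => ?_⟩
  have hq3 : 3 ≤ q ^ 3 := hq.trans (Nat.le_self_pow (by norm_num) q)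
  have hq2 : 3 ≤ q ^ 2 := hq.trans (Nat.le_self_pow (by norm_num) q)
  have h := (hasBoundedConf_one (x := x + 1) (by omega) hq3 hq2).join_iterate i
  have hpow : q ^ 3 * (q ^ 2 * q ^ 2) = q ^ 7 := by ring
  rw [hpow] at h
  refine ⟨h.hasConf, (h.ePrime_le hk).trans ?_⟩
  have h1 : 1 ≤ q ^ 6 := Nat.one_le_pow _ _ (by omega)
  have h3 : q ^ 3 ≤ q ^ 6 := Nat.pow_le_pow_right (by omega) (by norm_num)
  have h2 : q ^ 2 ≤ q ^ 6 := Nat.pow_le_pow_right (by omega) (by norm_num)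
  have h4 : q ^ 2 * q ^ 2 ≤ q ^ 6 := by
    rw [← pow_add]
    exact Nat.pow_le_pow_right (by omega) (by norm_num)
  have h5 : x + 1 + 2 * q ^ 3 + q ^ 2 * q ^ 2 + 2 * q ^ 2 + i ≤ (x + 6 + i) * q ^ 6 := by
    have : x + 1 + i ≤ (x + 1 + i) * q ^ 6 := Nat.le_mul_of_pos_right _ h1
    nlinarith
  have h6 : 4 * (q ^ 3) ^ 2 + 2 * (q ^ 2) ^ 3 = 6 * q ^ 6 := by ring
  rw [h6, add_mul, mul_assoc]
  gcongr

end

section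

theorem hasConf_and_ePrime_le {k t s s' : ℕ} (hk : 1 ≤ k) (h : HasConf k t s') (hs : s ≤ s') :
    HasConf k t s ∧ ePrime (k + 2) t s ≤ ePrime (k + 2) t s' + t ^ 2 * (s' - s) := by
  obtain ⟨j, rfl⟩ := Nat.exists_eq_add_of_le hs
  simpa using h.ePrime_le hk

theorem hasConf_all {k t : ℕ} (hk : 1 ≤ k) (ht : k + 5 ≤ t) (s : ℕ) : HasConf k t s := by
  obtain ⟨C, hC⟩ := exists_ePrime_pow_le hk ht
  refine (hasConf_and_ePrime_le hk (hC (s + 3) (by omega)).1 ?_).1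
  exact le_trans (by omega) (Nat.le_self_pow (by norm_num) (s + 3))

/-- `e'_{r,t}(s) = o(s)`. -/
theorem ePrime_isLittleO {k t : ℕ} (hk : 1 ≤ k) (ht : k + 5 ≤ t) (M : ℕ) :
    ∃ N, ∀ s, N ≤ s → M * ePrime (k + 2) t s ≤ s := by
  obtain ⟨C, hC⟩ := exists_ePrime_pow_le hk ht
  refine ⟨(M * (64 * (C + 7 * t ^ 2)) + 4) ^ 7, fun s hs => ?_⟩
  have hex : ∃ q, s ≤ q ^ 7 := ⟨s, Nat.le_self_pow (by norm_num) s⟩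
  obtain ⟨q, hq, hmin⟩ : ∃ q, s ≤ q ^ 7 ∧ ∀ p < q, p ^ 7 < s :=
    ⟨Nat.find hex, Nat.find_spec hex, fun p hp => not_le.1 (Nat.find_min hex hp)⟩
  have hq4 : M * (64 * (C + 7 * t ^ 2)) + 4 ≤ q :=
    le_of_not_gt fun h => absurd (hs.trans hq) (not_le.2 (Nat.pow_lt_pow_left h (by norm_num)))
  obtain ⟨p, rfl⟩ : ∃ p, q = p + 1 := ⟨q - 1, by omega⟩
  have hps := hmin p (by omega)
  have h1 := (hasConf_and_ePrime_le hk (hC (p + 1) (by omega)).1 hq).2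
  have h2 := (hC (p + 1) (by omega)).2
  have h3 : (p + 1) ^ 7 - s ≤ 7 * (p + 1) ^ 6 := by
    have : (p + 1) ^ 7 ≤ p ^ 7 + 7 * (p + 1) ^ 6 := by
      ring_nf
      nlinarith [Nat.zero_le (p ^ 5), Nat.zero_le (p ^ 4), Nat.zero_le (p ^ 3),
        Nat.zero_le (p ^ 2), Nat.zero_le p]
    omega
  have h4 : (p + 1) ^ 6 ≤ 64 * p ^ 6 := by
    calc (p + 1) ^ 6 ≤ (2 * p) ^ 6 := Nat.pow_le_pow_left (by omega) 6
      _ = 64 * p ^ 6 := by ring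
  have h5 : ePrime (k + 2) t s ≤ 64 * (C + 7 * t ^ 2) * p ^ 6 :=
    calc ePrime (k + 2) t s ≤ C * (p + 1) ^ 6 + t ^ 2 * (7 * (p + 1) ^ 6) :=
          h1.trans (add_le_add h2 (Nat.mul_le_mul_left _ h3))
      _ = (C + 7 * t ^ 2) * (p + 1) ^ 6 := by ring
      _ ≤ (C + 7 * t ^ 2) * (64 * p ^ 6) := Nat.mul_le_mul_left _ h4
      _ = 64 * (C + 7 * t ^ 2) * p ^ 6 := by ring
  calc M * ePrime (k + 2) t s ≤ M * (64 * (C + 7 * t ^ 2) * p ^ 6) := Nat.mul_le_mul_left _ h5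
    _ = (M * (64 * (C + 7 * t ^ 2))) * p ^ 6 := by ring
    _ ≤ p * p ^ 6 := Nat.mul_le_mul_right _ (by omega)
    _ = p ^ 7 := by ring
    _ ≤ s := hps.le

theorem ePrime_unbounded {k t : ℕ} (hk : 1 ≤ k) (ht : k + 5 ≤ t) (B : ℕ) :
    ∃ N, ∀ s, N ≤ s → B ≤ ePrime (k + 2) t s := by
  refine ⟨2 ^ (B + t), fun s hs => ?_⟩
  have h1 := hs.trans ((hasConf_all hk ht s).le_two_pow hk)
  have h2 := (Nat.pow_le_pow_iff_right (by norm_num : 1 < 2)).1 h1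
  omega

theorem tendsto_div_nhds_one {h : ℕ → ℕ}
    (hh : ∀ M : ℕ, ∃ N, ∀ n, N ≤ n → M * h n ≤ M * n + n ∧ M * n ≤ M * h n + n) :
    Filter.Tendsto (fun n : ℕ => (h n : ℝ) / (n : ℝ)) Filter.atTop (nhds 1) := by
  rw [Metric.tendsto_atTop]
  intro ε hε
  obtain ⟨M, hM⟩ := exists_nat_gt (1 / ε)
  obtain ⟨N, hN⟩ := hh M
  refine ⟨N + 1, fun n hn => ?_⟩
  obtain ⟨h1, h2⟩ := hN n (by omega)
  have hn0 : (0 : ℝ) < n := by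
    have : 0 < n := by omega
    exact_mod_cast this
  have hM0 : (0 : ℝ) < M := lt_trans (by positivity) hM
  have h1' : (M : ℝ) * h n ≤ M * n + n := by exact_mod_cast h1
  have h2' : (M : ℝ) * n ≤ M * h n + n := by exact_mod_cast h2
  have h3 : 1 < M * ε := by
    rw [div_lt_iff₀ hε] at hM
    exact hM
  rw [Real.dist_eq, abs_lt]
  have h4 : (n : ℝ) < M * ε * n := by nlinarith
  constructor
  · rw [lt_sub_iff_add_lt, lt_div_iff₀ hn0]
    by_contra hcon
    push Not at hcon
    nlinarith
  · rw [sub_lt_iff_lt_add, div_lt_iff₀ hn0]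
    by_contra hcon
    push Not at hcon
    nlinarith

/-- The choice of `f` for the lower bound: the minimiser of `e` slightly below `n`. -/
theorem exists_lower_index {e : ℕ → ℕ} (ho : ∀ M, ∃ N, ∀ s, N ≤ s → M * e s ≤ s)
    (hu : ∀ B, ∃ N, ∀ s, N ≤ s → B ≤ e s) (B C : ℕ) :
    ∃ (f : ℕ → ℕ) (N : ℕ),
      Filter.Tendsto (fun n : ℕ => (f n : ℝ) / (n : ℝ)) Filter.atTop (nhds 1) ∧
      ∀ n, N ≤ n → B ≤ e (f n) ∧ ∀ i ≤ n, n ≤ i + e n + C → e (f n) ≤ e i := by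
  have hex : ∀ n, ∃ m, (m ≤ n ∧ n ≤ m + e n + C) ∧
      ∀ i ≤ n, n ≤ i + e n + C → e m ≤ e i := by
    intro n
    obtain ⟨m, hm, hmin⟩ := ((Finset.range (n + 1)).filter
      fun m => n ≤ m + e n + C).exists_min_image e ⟨n, by simp; omega⟩
    simp only [Finset.mem_filter, Finset.mem_range] at hm hmin
    exact ⟨m, ⟨by omega, hm.2⟩, fun i hi hi' => hmin i ⟨by omega, hi'⟩⟩
  choose f hf hmin using hex
  have hclose : ∀ M, ∃ N, ∀ n, N ≤ n → M * (n - f n) ≤ n := by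
    intro M
    obtain ⟨N, hN⟩ := ho (2 * M)
    refine ⟨N + 2 * M * C, fun n hn => ?_⟩
    have h1 := hN n (le_trans (Nat.le_add_right _ _) hn)
    have h2 : n - f n ≤ e n + C := by have := (hf n).2; omega
    have h3 : M * (n - f n) ≤ M * (e n + C) := Nat.mul_le_mul_left _ h2
    nlinarith
  obtain ⟨N₁, hN₁⟩ := hclose 2
  obtain ⟨N₂, hN₂⟩ := hu B
  refine ⟨f, N₁ + 2 * N₂, tendsto_div_nhds_one fun M => ?_, fun n hn => ⟨hN₂ _ ?_, hmin n⟩⟩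
  · obtain ⟨N, hN⟩ := hclose M
    refine ⟨N, fun n hn => ?_⟩
    have h1 := hN n hn
    have h2 := (hf n).1
    obtain ⟨d, hd⟩ := Nat.exists_eq_add_of_le h2
    rw [show n - f n = d by omega] at h1
    constructor
    · nlinarith
    · have : M * n = M * f n + M * d := by rw [← mul_add, ← hd]
      omega
  · have := hN₁ n (by omega)
    omega

/-- The choice of `g` for the upper bound. -/
theorem exists_upper_index {e : ℕ → ℕ} (ho : ∀ M, ∃ N, ∀ s, N ≤ s → M * e s ≤ s)
    (hu : ∀ B, ∃ N, ∀ s, N ≤ s → B ≤ e s) {t : ℕ} (ht : 1 ≤ t)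
    (he : ∀ s, e s ≤ e (s + 1) + t ^ 2) :
    ∃ (g : ℕ → ℕ) (N C : ℕ),
      Filter.Tendsto (fun n : ℕ => (g n : ℝ) / (n : ℝ)) Filter.atTop (nhds 1) ∧
      ∀ n, N ≤ n → n + t * (e (g n) + t) ≤ g n ∧ (t + 1) * (e (g n) + t) ≤ n ∧
        g n ≤ n + C * e (g n) ∧ 1 ≤ e (g n) := by
  have hex : ∀ n, ∃ s, n ≤ s ∧ n + t * (e s + t) ≤ s := by
    intro n
    obtain ⟨N, hN⟩ := ho (2 * t)
    have h := hN (N + 2 * (n + t * t)) (by omega)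
    refine ⟨N + 2 * (n + t * t), by omega, ?_⟩
    have : 2 * t * e (N + 2 * (n + t * t)) = 2 * (t * e (N + 2 * (n + t * t))) := by ring
    rw [mul_add]
    omega
  have hex' : ∀ n, ∃ s, n ≤ s ∧ n + t * (e s + t) ≤ s ∧
      (s = n ∨ n + 1 ≤ s ∧ s - 1 < n + t * (e (s - 1) + t)) := by
    intro n
    have hmin := fun {m} => Nat.find_min (hex n) (m := m)
    have hspec := Nat.find_spec (hex n)
    refine ⟨Nat.find (hex n), hspec.1, hspec.2, ?_⟩
    rcases hspec.1.eq_or_lt with h | h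
    · exact Or.inl h.symm
    · right
      refine ⟨h, ?_⟩
      have := hmin (m := Nat.find (hex n) - 1) (by omega)
      by_contra hcon
      exact this ⟨by omega, by omega⟩
  choose g hg hg1 hg2 using hex'
  have hpred : ∀ n, ∃ d, g n = n + d ∧ (d = 0 ∨ d ≤ t * (e (n + d - 1) + t)) := by
    intro n
    obtain ⟨d, hd⟩ := Nat.exists_eq_add_of_le (hg n)
    refine ⟨d, hd, ?_⟩
    rcases hg2 n with h | ⟨h, h'⟩
    · left; omega
    · right
      rw [hd] at h'
      omega
  have hbound : ∀ n, g n ≤ n + t * e (g n) + (t ^ 3 + t ^ 2) := by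
    intro n
    obtain ⟨d, hd, h | h⟩ := hpred n
    · omega
    · rcases Nat.eq_zero_or_pos d with h0 | h0
      · omega
      have h1 := he (n + d - 1)
      rw [show n + d - 1 + 1 = n + d by omega] at h1
      rw [hd]
      have h2 : t * (e (n + d - 1) + t) ≤ t * (e (n + d) + t ^ 2 + t) :=
        Nat.mul_le_mul_left _ (by omega)
      nlinarith
  obtain ⟨N₁, hN₁⟩ := hu 1
  obtain ⟨N₂, hN₂⟩ := ho (3 * t + 2)
  refine ⟨g, N₁ + N₂ + (t ^ 3 + t ^ 2 + 2 * ((t + 1) * t)), t + (t ^ 3 + t ^ 2),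
    tendsto_div_nhds_one fun M => ?_, fun n hn => ⟨hg1 n, ?_, ?_, ?_⟩⟩
  · obtain ⟨N, hN⟩ := ho (4 * t * (M + 1))
    refine ⟨N + 4 * (M + 1) * t ^ 2 + 3 * (M + 1), fun n hn => ?_⟩
    obtain ⟨d, hd, h⟩ := hpred n
    have hMd : M * d ≤ n := by
      rcases h with rfl | h
      · simp
      rcases Nat.eq_zero_or_pos d with h0 | h0
      · simp [h0]
      have h1 := hN (n + d - 1) (by have := Nat.zero_le (4 * (M + 1) * t ^ 2); omega)
      have h3 : 4 * (M + 1) * d ≤ 4 * (M + 1) * (t * (e (n + d - 1) + t)) :=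
        Nat.mul_le_mul_left _ h
      have h4 : 4 * (M + 1) * (t * (e (n + d - 1) + t)) =
          4 * t * (M + 1) * e (n + d - 1) + 4 * (M + 1) * t ^ 2 := by ring
      have h5 : n + d - 1 ≤ n + d := by omega
      nlinarith
    rw [hd]
    constructor <;> nlinarith
  · have h1 := hN₂ (g n) (le_trans (by omega) (hg n))
    have h2 := hbound n
    nlinarith
  · have h1 := hbound n
    have h2 := hN₁ (g n) (le_trans (by omega) (hg n))
    nlinarith [Nat.zero_le (t ^ 3 + t ^ 2)]
  · exact hN₁ (g n) (le_trans (by omega) (hg n))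

end

section

open Finset
open scoped Classical

/-- Minimum degree at least `t` on `W`, and distinct twins have a common neighbour in `I`. -/
structure Tidy (t : ℕ) {V : Type} [Fintype V] (G : SimpleGraph V) (W I : Finset V) : Prop where
  le_degree : ∀ v ∈ W, t ≤ G.degree v
  twin : ∀ u ∈ W, ∀ v ∈ W, u ≠ v → (∀ x, G.Adj u x ↔ G.Adj v x) → ∃ w ∈ I, G.Adj w u ∧ G.Adj w v

/-- Deleting one of two twins that have no neighbour in `I`. -/
theorem Conf.exists_deleteTwin {k t : ℕ} {V : Type} [Fintype V] {G : SimpleGraph V}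
    {W I : Finset V} (h : Conf k t G W I) {u v : V} (hv : v ∈ W) (huv : u ≠ v)
    (htw : ∀ x, G.Adj u x ↔ G.Adj v x) (hI : ∀ w ∈ I, ¬ G.Adj u w) :
    ∃ G' : SimpleGraph V, Conf k t G' (W \ {u}) (I \ {u}) ∧ #G'.edgeFinset ≤ #G.edgeFinset := by
  obtain ⟨G', hG'⟩ := G.exists_adj_iff_notMem {u}
  have hle : G' ≤ G := fun x y hxy => ((hG' x y).1 hxy).1
  have hsat : SatOn k G' (W \ {u}) := by
    refine ⟨fun x y hxy => ?_, h.free.anti hle, fun x hx y hy hxy hadj => ?_⟩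
    · rw [hG'] at hxy
      exact mem_sdiff.2 ⟨h.supp _ _ hxy.1, hxy.2.1⟩
    · rw [mem_sdiff] at hx hy
      rw [hG'] at hadj
      obtain ⟨d, hd, hd'⟩ := h.sat x hx.1 y hy.1 hxy fun h' => hadj ⟨h', hx.2, hy.2⟩
      obtain ⟨d', hd1, hd2, hd3⟩ : ∃ d', u ∉ d' ∧ G.IsNClique k d' ∧
          ∀ z ∈ d', G.Adj x z ∧ G.Adj y z := by
        by_cases hud : u ∈ d
        · obtain ⟨j, rfl⟩ : ∃ j, k = j + 1 := by
            have := card_pos.2 ⟨u, hud⟩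
            rw [hd.2] at this
            exact ⟨k - 1, by omega⟩
          refine ⟨insert v (d.erase u), by simp [huv],
            IsNClique.insert (by simpa using hd.erase_of_mem hud) fun b hb => ?_, fun z hz => ?_⟩
          · rw [mem_erase] at hb
            exact (htw b).1 (hd.1 hud hb.2 (Ne.symm hb.1))
          · rcases mem_insert.1 hz with rfl | hz
            · exact ⟨((htw x).1 (hd' u hud).1.symm).symm, ((htw y).1 (hd' u hud).2.symm).symm⟩
            · exact hd' z (mem_of_mem_erase hz)
        · exact ⟨d, hud, hd, hd'⟩
      have hne : ∀ z ∈ d', z ∉ ({u} : Finset V) := by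
        intro z hz hzu
        rw [mem_singleton] at hzu
        exact hd1 (hzu ▸ hz)
      refine ⟨d', ⟨fun a ha b hb hab => (hG' _ _).2 ⟨hd2.1 ha hb hab, hne a ha, hne b hb⟩, hd2.2⟩,
        fun z hz => ⟨(hG' _ _).2 ⟨(hd3 z hz).1, hx.2, hne z hz⟩,
          (hG' _ _).2 ⟨(hd3 z hz).2, hy.2, hne z hz⟩⟩⟩
  refine ⟨G', (h.of_removeSet hsat (fun x y hxy => ?_) (fun x y hx hy hxy => ?_) ?_).1, ?_⟩
  · rw [hG'] at hxy
    exact ⟨hxy.2.1, hxy.2.2, Or.inl hxy.1⟩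
  · exact (hG' _ _).2 ⟨hxy, hx, hy⟩
  · intro x hx y hy
    rw [mem_singleton] at hx
    exact hx ▸ hI y (mem_sdiff.1 hy).1
  · exact card_le_card (edgeFinset_subset_edgeFinset.2 hle)

theorem Conf.exists_deleteLow {k t : ℕ} {V : Type} [Fintype V] {G : SimpleGraph V}
    {W I : Finset V} (h : Conf k t G W I) {u : V} (hu : G.degree u < t) :
    ∃ (G' : SimpleGraph V) (X : Finset V), u ∈ X ∧ Conf k t G' (W \ X) (I \ X) ∧
      #I ≤ #(I \ X) + t ∧ #G'.edgeFinset + t * #I ≤ #G.edgeFinset + t * #(I \ X) + t ^ 3 := by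
  have huI : u ∉ I := fun hI => by
    have := h.deg u hI
    omega
  let J := I.filter fun v => G.Adj u v
  have hJ : #J + 1 ≤ t := by
    have : J ⊆ G.neighborFinset u := fun x hx => by
      simpa using (mem_filter.1 hx).2
    have := card_le_card this
    rw [card_neighborFinset_eq_degree] at this
    omega
  obtain ⟨G', h', hup, hkeep, hcard⟩ := h.toSatOn.exists_removeSet (insert u J)
  have hX : ∀ x ∈ insert u J, ∀ y ∈ I \ insert u J, ¬ G.Adj x y := by
    intro x hx y hy hxy
    rw [mem_sdiff, mem_insert, not_or] at hy
    rcases mem_insert.1 hx with rfl | hx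
    · exact hy.2.2 (mem_filter.2 ⟨hy.1, hxy⟩)
    · exact h.indep x (mem_filter.1 hx).1 y hy.1 hxy
  have hIX : I \ insert u J = I \ J := by
    ext x
    simp only [mem_sdiff, mem_insert, not_or]
    refine and_congr_right fun hx => ⟨fun h => h.2, fun h => ⟨?_, h⟩⟩
    rintro rfl
    exact huI hx
  have hcI : #(I \ J) + #J = #I := card_sdiff_add_card_eq_card (filter_subset _ _)
  refine ⟨G', insert u J, mem_insert_self _ _, (h.of_removeSet h' hup hkeep hX).1, ?_, ?_⟩
  · rw [hIX]
    omega
  · have h1 := hcard J (subset_insert _ _) fun x hx y hy =>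
      h.indep x (mem_filter.1 hx).1 y (mem_filter.1 hy).1
    rw [sum_congr rfl fun x hx => h.deg x (mem_filter.1 hx).1, sum_const, smul_eq_mul] at h1
    have h2 : ∑ v ∈ insert u J, G.degree v ^ 2 ≤ t ^ 3 := by
      calc ∑ v ∈ insert u J, G.degree v ^ 2 ≤ ∑ v ∈ insert u J, t ^ 2 := by
            refine sum_le_sum fun v hv => Nat.pow_le_pow_left ?_ 2
            rcases mem_insert.1 hv with rfl | hv
            · exact hu.le
            · exact (h.deg v (mem_filter.1 hv).1).le
        _ ≤ t * t ^ 2 := by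
            rw [sum_const, smul_eq_mul]
            exact Nat.mul_le_mul_right _ ((card_insert_le _ _).trans hJ)
        _ = t ^ 3 := by ring
    rw [hIX, ← hcI]
    nlinarith

/-- Every configuration can be made tidy at a cost controlled by the number of vertices
outside `I`. -/
theorem Conf.exists_tidy {k t : ℕ} {V : Type} [Fintype V] (m : ℕ) :
    ∀ {G : SimpleGraph V} {W I : Finset V}, Conf k t G W I → #(W \ I) ≤ m →
    ∃ (G' : SimpleGraph V) (W' I' : Finset V), Conf k t G' W' I' ∧ Tidy t G' W' I' ∧
      #(W' \ I') ≤ m ∧ #I' ≤ #I ∧ #I ≤ #I' + t * m ∧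
      #G'.edgeFinset + t * #I ≤ #G.edgeFinset + t * #I' + t ^ 3 * m := by
  induction m with
  | zero =>
    intro G W I h hm
    have hWI : ∀ x ∈ W, x ∈ I := by
      rw [Nat.le_zero, card_eq_zero, sdiff_eq_empty_iff_subset] at hm
      exact fun x hx => hm hx
    refine ⟨G, W, I, h, ⟨fun v hv => (h.deg v (hWI v hv)).ge, fun u hu v hv huv htw => ?_⟩,
      hm, le_rfl, by simp, by simp⟩
    exact absurd (h.inj u (hWI u hu) v (hWI v hv) htw) huv
  | succ m ih =>
    intro G W I h hm
    have hstep : ∀ (X : Finset V) (u : V), u ∈ W → u ∉ I → u ∈ X →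
        #((W \ X) \ (I \ X)) ≤ m := by
      intro X u huW huI huX
      have hss : (W \ X) \ (I \ X) ⊂ W \ I := by
        rw [ssubset_iff_of_subset]
        · exact ⟨u, mem_sdiff.2 ⟨huW, huI⟩, fun h => (mem_sdiff.1 (mem_sdiff.1 h).1).2 huX⟩
        · intro x hx
          simp only [mem_sdiff] at hx ⊢
          tauto
      have := card_lt_card hss
      omega
    by_cases hlow : ∃ u ∈ W, G.degree u < t
    · obtain ⟨u, huW, hu⟩ := hlow
      have huI : u ∉ I := fun hI => by
        have := h.deg u hI
        omega
      obtain ⟨G₁, X, huX, h₁, hI₁, he₁⟩ := h.exists_deleteLow hu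
      obtain ⟨G', W', I', h', htidy, hm', hII', hI', he'⟩ := ih h₁ (hstep X u huW huI huX)
      have hIX : #(I \ X) ≤ #I := card_le_card sdiff_subset
      exact ⟨G', W', I', h', htidy, by omega, by omega, by rw [Nat.mul_succ]; omega,
        by rw [Nat.mul_succ]; omega⟩
    push Not at hlow
    by_cases htwin : ∀ u ∈ W, ∀ v ∈ W, u ≠ v → (∀ x, G.Adj u x ↔ G.Adj v x) →
        ∃ w ∈ I, G.Adj w u ∧ G.Adj w v
    · exact ⟨G, W, I, h, ⟨hlow, htwin⟩, hm, le_rfl, by omega, by omega⟩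
    push Not at htwin
    have hbad : ∃ u ∈ W, ∃ v ∈ W, u ≠ v ∧ (∀ x, G.Adj u x ↔ G.Adj v x) ∧
        (∀ w ∈ I, ¬ G.Adj u w) ∧ u ∉ I := by
      obtain ⟨u, hu, v, hv, huv, htw, hI⟩ := htwin
      have h1 : ∀ w ∈ I, ¬ G.Adj u w := fun w hw hadj =>
        hI w hw hadj.symm ((htw w).1 hadj).symm
      by_cases huI : u ∈ I
      · refine ⟨v, hv, u, hu, huv.symm, fun x => (htw x).symm,
          fun w hw => by rw [← htw]; exact h1 w hw, fun hvI => huv (h.inj u huI v hvI htw)⟩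
      · exact ⟨u, hu, v, hv, huv, htw, h1, huI⟩
    obtain ⟨u, hu, v, hv, huv, htw, hI, huI⟩ := hbad
    obtain ⟨G₁, h₁, he₁⟩ := h.exists_deleteTwin hv huv htw hI
    have hIu : I \ {u} = I := by
      ext x
      simp only [mem_sdiff, mem_singleton]
      exact ⟨fun h => h.1, fun hx => ⟨hx, fun hxu => huI (hxu ▸ hx)⟩⟩
    obtain ⟨G', W', I', h', htidy, hm', hII', hI', he'⟩ :=
      ih h₁ (hstep {u} u hu huI (mem_singleton_self u))
    rw [hIu] at hII' hI' he'
    exact ⟨G', W', I', h', htidy, by omega, hII', by rw [Nat.mul_succ]; omega,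
      by rw [Nat.mul_succ]; omega⟩

/-- Shrinking a tidy configuration to `n` vertices by removing distinguished vertices. -/
theorem Conf.exists_shrink {k t n : ℕ} (ht : 1 ≤ t) {V : Type} [Fintype V] {G : SimpleGraph V}
    {W I : Finset V} (h : Conf k t G W I) (htidy : Tidy t G W I)
    (hn : (t + 1) * #(W \ I) ≤ n) (hW : n ≤ #W) :
    ∃ (G' : SimpleGraph V) (W' I' : Finset V), Conf k t G' W' I' ∧ Tidy t G' W' I' ∧
      #W' = n ∧
      #G'.edgeFinset + t * (#W - n) ≤ #G.edgeFinset + t ^ 2 * (#W - n) := by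
  have hM : ∀ v : V, ∃ M ⊆ I.filter (G.Adj v), #M ≤ t ∧ (#M < t → M = I.filter (G.Adj v)) := by
    intro v
    by_cases hc : t ≤ #(I.filter (G.Adj v))
    · obtain ⟨M, hM, hMc⟩ := exists_subset_card_eq hc
      exact ⟨M, hM, hMc.le, fun h => by omega⟩
    · exact ⟨_, le_rfl, by omega, fun _ => rfl⟩
  choose M hMsub hMt hMlt using hM
  let Z := (W \ I).biUnion M
  have hZ : #Z ≤ t * #(W \ I) := by
    rw [mul_comm]
    exact card_biUnion_le_card_mul _ _ _ fun v _ => hMt v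
  have hWc : #(W \ I) + #I = #W := card_sdiff_add_card_eq_card h.sub
  have hIZ := le_card_sdiff Z I
  obtain ⟨X, hXsub, hXc⟩ := exists_subset_card_eq (s := I \ Z) (n := #W - n) (by
    rw [add_mul, one_mul] at hn
    omega)
  have hXI : X ⊆ I := hXsub.trans sdiff_subset
  have hMX : ∀ v ∈ W, v ∉ I → ∀ x ∈ M v, x ∉ X := fun v hv hvI x hx hxX =>
    (mem_sdiff.1 (hXsub hxX)).2 (mem_biUnion.2 ⟨v, mem_sdiff.2 ⟨hv, hvI⟩, hx⟩)
  obtain ⟨G', hc', hnb, hup, hkeep, hcard⟩ := h.exists_removeSet hXI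
  rw [hXc] at hcard
  have hmemI : ∀ v x, x ∈ M v → x ∈ I ∧ G.Adj v x := fun v x hx => by
    simpa using hMsub v hx
  refine ⟨G', W \ X, I \ X, hc', ⟨?_, ?_⟩, ?_, hcard⟩
  · intro v hv
    rw [mem_sdiff] at hv
    by_cases hvI : v ∈ I
    · exact (hc'.deg v (mem_sdiff.2 ⟨hvI, hv.2⟩)).ge
    · by_cases hlt : #(M v) < t
      · refine (htidy.le_degree v hv.1).trans ?_
        rw [← card_neighborFinset_eq_degree, ← card_neighborFinset_eq_degree]
        refine card_le_card fun x hx => ?_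
        rw [mem_neighborFinset] at hx ⊢
        refine hkeep _ _ hv.2 (fun hxX => ?_) hx
        refine hMX v hv.1 hvI x ?_ hxX
        rw [hMlt v hlt]
        exact mem_filter.2 ⟨hXI hxX, hx⟩
      · refine (not_lt.1 hlt).trans ?_
        rw [← card_neighborFinset_eq_degree]
        refine card_le_card fun x hx => ?_
        rw [mem_neighborFinset]
        exact hkeep _ _ hv.2 (hMX v hv.1 hvI x hx) (hmemI v x hx).2
  · intro u hu v hv huv htw
    by_contra hcon
    push Not at hcon
    rw [mem_sdiff] at hu hv
    have hu0 : ∀ w ∈ I \ X, ¬ G'.Adj u w := fun w hw hadj =>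
      hcon w hw hadj.symm ((htw w).1 hadj).symm
    have hv0 : ∀ w ∈ I \ X, ¬ G'.Adj v w := fun w hw => by
      rw [← htw]
      exact hu0 w hw
    have key : ∀ z ∈ W, z ∉ X → (∀ w ∈ I \ X, ¬ G'.Adj z w) →
        (∀ w ∈ I, ¬ G.Adj z w) ∧ ∀ x, G'.Adj z x ↔ G.Adj z x := by
      intro z hzW hzX hz
      by_cases hzI : z ∈ I
      · exact ⟨fun w hw => h.indep z hzI w hw, hnb z (mem_sdiff.2 ⟨hzI, hzX⟩)⟩
      · have hMz : M z = ∅ := by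
          refine eq_empty_of_forall_notMem fun x hx => ?_
          exact hz x (mem_sdiff.2 ⟨(hmemI z x hx).1, hMX z hzW hzI x hx⟩)
            (hkeep _ _ hzX (hMX z hzW hzI x hx) (hmemI z x hx).2)
        have hno : ∀ w ∈ I, ¬ G.Adj z w := by
          intro w hw hadj
          have h1 := hMlt z (by rw [hMz, card_empty]; omega)
          have h2 : w ∈ I.filter (G.Adj z) := mem_filter.2 ⟨hw, hadj⟩
          rw [← h1, hMz] at h2
          simp at h2
        refine ⟨hno, fun x => ⟨fun hx => ?_, fun hx => ?_⟩⟩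
        · obtain ⟨-, -, h1 | ⟨w, hw, h1, -⟩⟩ := hup z x hx
          · exact h1
          · exact absurd h1.symm (hno w (hXI hw))
        · exact hkeep _ _ hzX (fun hxX => hno x (hXI hxX) hx) hx
    obtain ⟨hu1, hu2⟩ := key u hu.1 hu.2 hu0
    obtain ⟨hv1, hv2⟩ := key v hv.1 hv.2 hv0
    obtain ⟨w, hw, hwu, -⟩ := htidy.twin u hu.1 v hv.1 huv fun x => by
      rw [← hu2, ← hv2, htw]
    exact hu1 w hw hwu.symm
  · rw [card_sdiff_of_subset (hXI.trans h.sub), hXc]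
    omega

/-- A tidy configuration on `n` vertices gives a graph on `Fin n` as required in the upper bound. -/
theorem Conf.exists_fin {k t n : ℕ} {V : Type} [Fintype V] {G : SimpleGraph V}
    {W I : Finset V} (h : Conf k t G W I) (htidy : Tidy t G W I) (hW : #W = n) :
    ∃ K : SimpleGraph (Fin n), Ksat (k + 2) K ∧ MinDegGe K t ∧ TwinCond K t ∧
      K.edgeSet.ncard = #G.edgeFinset := by
  subst hW
  let f : Fin #W ↪ V := W.equivFin.symm.toEmbedding.trans (Function.Embedding.subtype _)
  have hf : ∀ i, f i ∈ W := fun i => (W.equivFin.symm i).2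
  have hf' : ∀ x ∈ W, ∃ i, f i = x := fun x hx => ⟨W.equivFin ⟨x, hx⟩, by simp [f]⟩
  have hsupp : ∀ u v, G.Adj u v → v ∈ W := fun u v huv => h.supp _ _ huv.symm
  let K : SimpleGraph (Fin #W) := G.comap f
  have hK : ∀ i j, K.Adj i j ↔ G.Adj (f i) (f j) := fun _ _ => Iff.rfl
  have hmap : K.map f = G := by
    ext x y
    rw [map_adj]
    constructor
    · rintro ⟨i, j, hij, rfl, rfl⟩
      exact hij
    · intro hxy
      obtain ⟨i, rfl⟩ := hf' x (h.supp _ _ hxy)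
      obtain ⟨j, rfl⟩ := hf' y (hsupp _ _ hxy)
      exact ⟨i, j, hxy, rfl, rfl⟩
  have hns : ∀ i, (K.neighborSet i).ncard = G.degree (f i) := by
    intro i
    rw [← ncard_neighborSet, ← Set.ncard_image_of_injective _ f.injective]
    congr 1
    ext x
    constructor
    · rintro ⟨j, hj, rfl⟩
      exact hj
    · intro hx
      obtain ⟨j, rfl⟩ := hf' x (hsupp _ _ hx)
      exact ⟨j, hx, rfl⟩
  have htw : ∀ i j, K.neighborSet i = K.neighborSet j → ∀ x, G.Adj (f i) x ↔ G.Adj (f j) x := by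
    intro i j hij x
    by_cases hx : x ∈ W
    · obtain ⟨l, rfl⟩ := hf' x hx
      exact Set.ext_iff.1 hij l
    · exact ⟨fun h => absurd (hsupp _ _ h) hx, fun h => absurd (hsupp _ _ h) hx⟩
  refine ⟨K, SatOn.ksat_of_univ ⟨fun _ _ _ => mem_univ _, fun c hc => h.free (c.map f)
      ⟨fun a ha b hb hab => ?_, by rw [card_map, hc.2]⟩, ?_⟩,
    fun i => ?_, fun i j hij hN => ?_, ?_⟩
  · obtain ⟨i, hi, rfl⟩ := mem_map.1 (mem_coe.1 ha)
    obtain ⟨j, hj, rfl⟩ := mem_map.1 (mem_coe.1 hb)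
    exact hc.1 hi hj fun h => hab (h ▸ rfl)
  · intro i _ j _ hij hadj
    obtain ⟨d, hd, hd'⟩ := h.sat (f i) (hf i) (f j) (hf j) (fun h => hij (f.injective h)) hadj
    refine ⟨univ.filter fun l => f l ∈ d, ⟨fun a ha b hb hab => ?_, ?_⟩, fun l hl => ?_⟩
    · simp only [coe_filter, mem_univ, true_and, Set.mem_ofPred_eq] at ha hb
      exact hd.1 ha hb fun h => hab (f.injective h)
    · rw [← hd.2, ← card_map f]
      congr 1
      ext x
      simp only [mem_map, mem_filter, mem_univ, true_and]
      constructor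
      · rintro ⟨l, hl, rfl⟩
        exact hl
      · intro hx
        obtain ⟨l, rfl⟩ := hf' x (hsupp _ _ (hd' x hx).1)
        exact ⟨l, hx, rfl⟩
    · simp only [mem_filter, mem_univ, true_and] at hl
      exact hd' _ hl
  · rw [hns]
    exact htidy.le_degree _ (hf i)
  · obtain ⟨w, hw, hwi, hwj⟩ := htidy.twin (f i) (hf i) (f j) (hf j)
      (fun h => hij (f.injective h)) (htw i j hN)
    obtain ⟨l, rfl⟩ := hf' w (h.sub hw)
    exact ⟨l, by rw [hns, h.deg _ hw], hwi, hwj⟩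
  · rw [← ncard_edgeSet, ← hmap, edgeSet_map, Set.ncard_image_of_injective _ f.sym2Map.injective]

theorem exists_graph_le {k t n s : ℕ} (hk : 1 ≤ k) (ht : 1 ≤ t) (hs : HasConf k t s)
    (h1 : n + t * (ePrime (k + 2) t s + t) ≤ s) (h2 : (t + 1) * (ePrime (k + 2) t s + t) ≤ n) :
    ∃ K : SimpleGraph (Fin n), Ksat (k + 2) K ∧ MinDegGe K t ∧ TwinCond K t ∧
      K.edgeSet.ncard ≤ t * n + ePrime (k + 2) t s + (t ^ 3 + t ^ 2) * (ePrime (k + 2) t s + t) +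
        t ^ 2 * (s - n) := by
  obtain ⟨V, _, G, I, hc, rfl, he⟩ := hs.exists_conf hk
  set e := ePrime (k + 2) t #I with he_def
  have hI : I.Nonempty := by
    rw [← card_pos]
    have : 0 < (t + 1) * (e + t) := by positivity
    omega
  have hm : #(univ \ I) ≤ e + t := by
    have := hc.card_sdiff_add_le hk hI
    omega
  obtain ⟨G₁, W₁, I₁, hc₁, htidy₁, hm₁, hWI, hI₁, he₁⟩ := hc.exists_tidy (e + t) hm
  have hW₁ : #(W₁ \ I₁) + #I₁ = #W₁ := card_sdiff_add_card_eq_card hc₁.sub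
  obtain ⟨G₂, W₂, I₂, hc₂, htidy₂, hW₂, he₂⟩ := hc₁.exists_shrink (n := n) ht htidy₁
    ((Nat.mul_le_mul_left _ hm₁).trans h2) (by omega)
  obtain ⟨K, hK1, hK2, hK3, hK4⟩ := hc₂.exists_fin htidy₂ hW₂
  refine ⟨K, hK1, hK2, hK3, ?_⟩
  rw [hK4]
  obtain ⟨q, hq⟩ := Nat.exists_eq_add_of_le (show n ≤ #W₁ by omega)
  rw [hq, Nat.add_sub_cancel_left] at he₂
  obtain ⟨p, hp⟩ := Nat.exists_eq_add_of_le (show n ≤ #I by omega)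
  rw [show #I - n = p by omega]
  have hqp : q ≤ p + (e + t) := by omega
  have h3 : t ^ 2 * q ≤ t ^ 2 * (p + (e + t)) := Nat.mul_le_mul_left _ hqp
  have h4 : t * #I₁ ≤ t * (n + q) := Nat.mul_le_mul_left _ (by omega)
  nlinarith

end

section

open Finset
open scoped Classical

/-- A crude form of Bollobás's two families theorem. -/
theorem card_le_of_cross_intersecting {ι α : Type*} (a b : ℕ) :
    ∀ (s : Finset ι) (P Q : ι → Finset α), (∀ i ∈ s, #(P i) ≤ a) → (∀ i ∈ s, #(Q i) ≤ b) →
      (∀ i ∈ s, Disjoint (P i) (Q i)) →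
      (∀ i ∈ s, ∀ j ∈ s, i ≠ j → ∃ x ∈ P i, x ∈ Q j) → #s ≤ (a + 1) ^ b := by
  induction b with
  | zero =>
    intro s P Q _ hQ _ hPQ
    rw [pow_zero, card_le_one]
    intro i hi j hj
    by_contra hij
    obtain ⟨x, -, hx⟩ := hPQ i hi j hj hij
    have := hQ j hj
    rw [Nat.le_zero, card_eq_zero] at this
    simp [this] at hx
  | succ b ih =>
    intro s P Q hP hQ hd hPQ
    obtain rfl | ⟨i₀, hi₀⟩ := s.eq_empty_or_nonempty
    · simp
    have hcover : s.erase i₀ ⊆ (P i₀).biUnion fun x => s.filter fun j => x ∈ Q j := by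
      intro j hj
      rw [mem_erase] at hj
      obtain ⟨x, hx, hx'⟩ := hPQ i₀ hi₀ j hj.2 (Ne.symm hj.1)
      exact mem_biUnion.2 ⟨x, hx, mem_filter.2 ⟨hj.2, hx'⟩⟩
    have hfib : ∀ x ∈ P i₀, #(s.filter fun j => x ∈ Q j) ≤ (a + 1) ^ b := by
      intro x _
      refine ih _ P (fun j => (Q j).erase x) (fun i hi => hP i (mem_filter.1 hi).1)
        (fun i hi => ?_) (fun i hi => ?_) fun i hi j hj hij => ?_
      · rw [mem_filter] at hi
        have := hQ i hi.1
        rw [card_erase_of_mem hi.2]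
        omega
      · exact (hd i (mem_filter.1 hi).1).mono_right (erase_subset _ _)
      · rw [mem_filter] at hi hj
        obtain ⟨z, hz, hz'⟩ := hPQ i hi.1 j hj.1 hij
        refine ⟨z, hz, mem_erase.2 ⟨?_, hz'⟩⟩
        rintro rfl
        exact Finset.disjoint_left.1 (hd i hi.1) hz hi.2
    have h1 := (card_le_card hcover).trans (card_biUnion_le_card_mul _ _ _ hfib)
    have h2 : #(P i₀) * (a + 1) ^ b ≤ a * (a + 1) ^ b := Nat.mul_le_mul_right _ (hP i₀ hi₀)
    have h3 : 1 ≤ (a + 1) ^ b := Nat.one_le_pow _ _ (by omega)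
    rw [card_erase_of_mem hi₀] at h1
    rw [pow_succ, mul_add, mul_one, mul_comm _ a]
    omega

theorem exists_private_cover {V : Type*} (R : V → V → Prop) (T Z : Finset V)
    (h : ∀ a ∈ T, ∃ z ∈ Z, R a z) :
    ∃ Z' ⊆ Z, (∀ a ∈ T, ∃ z ∈ Z', R a z) ∧
      ∀ z ∈ Z', ∃ a ∈ T, R a z ∧ ∀ z' ∈ Z', R a z' → z' = z := by
  let Covers : Finset V → Prop := fun Z' => ∀ a ∈ T, ∃ z ∈ Z', R a z
  obtain ⟨Z', hZ', hmin⟩ := exists_min_image (Z.powerset.filter Covers) card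
    ⟨Z, mem_filter.2 ⟨mem_powerset_self Z, h⟩⟩
  rw [mem_filter, mem_powerset] at hZ'
  refine ⟨Z', hZ'.1, hZ'.2, fun z hz => ?_⟩
  by_contra hcon
  push Not at hcon
  have := hmin (Z'.erase z) (mem_filter.2
    ⟨mem_powerset.2 ((erase_subset _ _).trans hZ'.1), fun a ha => ?_⟩)
  · have := card_erase_lt_of_mem hz
    omega
  · obtain ⟨w, hw, hw'⟩ := hZ'.2 a ha
    by_cases hwz : w = z
    · subst hwz
      obtain ⟨z', hz', hR, hne⟩ := hcon a ha hw'
      exact ⟨z', mem_erase.2 ⟨hne, hz'⟩, hR⟩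
    · exact ⟨w, mem_erase.2 ⟨hwz, hw⟩, hw'⟩

/-- The bound on the number of vertices of low degree into `U` dominated by vertices of low
degree whose neighbourhoods lie in `U`. -/
def coverBound (K : ℕ) : ℕ := (2 ^ K + 2) ^ (2 ^ K + 1) * K

theorem SatOn.card_le_coverBound {k K : ℕ} {V : Type} [Fintype V] {G : SimpleGraph V}
    (h : SatOn k G univ) {T Z U : Finset V} (hT : ∀ a ∈ T, #(G.neighborFinset a ∩ U) ≤ K)
    (hZU : ∀ z ∈ Z, G.neighborFinset z ⊆ U) (hZ : ∀ z ∈ Z, G.degree z ≤ K)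
    (hTZ : ∀ a ∈ T, ∃ z ∈ Z, G.Adj a z) : #T ≤ coverBound K := by
  obtain ⟨Z', hZ', hcov, hpriv⟩ := exists_private_cover G.Adj T Z hTZ
  choose! p hpT hpadj hpriv using hpriv
  have hZ'card : #Z' ≤ (2 ^ K + 1 + 1) ^ (2 ^ K + 1) := by
    refine card_le_of_cross_intersecting (2 ^ K + 1) (2 ^ K + 1) Z'
      (fun z => ({z} : Finset V).disjSum
        ((G.neighborFinset z).powerset.filter fun d => G.IsNClique k d))
      (fun z => ({p z} : Finset V).disjSum
        ((G.neighborFinset (p z) ∩ U).powerset.filter fun d => G.IsNClique k d))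
      (fun z hz => ?_) (fun z hz => ?_) (fun z hz => ?_) fun z hz z' hz' hne => ?_
    · have h1 := card_filter_le (G.neighborFinset z).powerset fun d => G.IsNClique k d
      rw [card_powerset, card_neighborFinset_eq_degree] at h1
      have h2 := Nat.pow_le_pow_right (n := 2) (by omega) (hZ z (hZ' hz))
      rw [card_disjSum, card_singleton]
      omega
    · have h1 := card_filter_le (G.neighborFinset (p z) ∩ U).powerset fun d => G.IsNClique k d
      rw [card_powerset] at h1
      have h2 := Nat.pow_le_pow_right (n := 2) (by omega) (hT (p z) (hpT z hz))
      rw [card_disjSum, card_singleton]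
      omega
    · rw [Finset.disjoint_left]
      rintro (x | d) hx hx'
      · rw [inl_mem_disjSum, mem_singleton] at hx hx'
        exact (hpadj z hz).ne (hx'.symm.trans hx)
      · rw [inr_mem_disjSum, mem_filter, mem_powerset] at hx hx'
        refine h.free (insert z (insert (p z) d)) ((hx.2.insert fun b hb => ?_).insert
          fun b hb => ?_)
        · simpa using (mem_inter.1 (hx'.1 hb)).1
        · rcases mem_insert.1 hb with rfl | hb
          · exact (hpadj z hz).symm
          · simpa using hx.1 hb
    · by_cases heq : z = p z'
      · exact ⟨Sum.inl z, by simp, by simp [← heq]⟩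
      · obtain ⟨d, hd, hd'⟩ := h.sat z (mem_univ _) (p z') (mem_univ _) heq
          fun hadj => hne (hpriv z' hz' z hz hadj.symm)
        have hdz : d ⊆ G.neighborFinset z := fun x hx => by simpa using (hd' x hx).1
        refine ⟨Sum.inr d, ?_, ?_⟩
        · rw [inr_mem_disjSum, mem_filter, mem_powerset]
          exact ⟨hdz, hd⟩
        · rw [inr_mem_disjSum, mem_filter, mem_powerset]
          exact ⟨fun x hx => mem_inter.2 ⟨by simpa using (hd' x hx).2,
            hZU z (hZ' hz) (hdz hx)⟩, hd⟩
  have hcover : T ⊆ Z'.biUnion fun z => G.neighborFinset z := by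
    intro a ha
    obtain ⟨z, hz, haz⟩ := hcov a ha
    exact mem_biUnion.2 ⟨z, hz, by simpa using haz.symm⟩
  refine (card_le_card hcover).trans ((card_biUnion_le_card_mul _ _ K fun z hz => ?_).trans
    (Nat.mul_le_mul_right _ hZ'card))
  rw [card_neighborFinset_eq_degree]
  exact hZ z (hZ' hz)

/-- In a saturated graph as in the lower bound, the vertices of degree `t` in a suitable
independent set form a configuration, and every other vertex contributes an extra edge. -/
theorem SatOn.exists_conf {k t : ℕ} {V : Type} [Fintype V] {G : SimpleGraph V}
    (h : SatOn k G univ) (hdeg : MinDegGe G t) (htw : TwinCond G t) :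
    ∃ I : Finset V, Conf k t G univ I ∧
      (t + 1) * Fintype.card V ≤ #G.edgeFinset + #I + 2 * (t + 1) * coverBound (2 * t + 1) := by
  have hdeg' : ∀ v, t ≤ G.degree v := fun v => by
    rw [← ncard_neighborSet]
    exact hdeg v
  set L := 2 * t + 1 with hL
  let low := univ.filter fun v => G.degree v ≤ L
  have hlow : ∀ v, v ∈ low ↔ G.degree v ≤ L := by simp [low]
  let Y := low.filter fun v => ∀ x, G.Adj v x → x ∉ low
  let bad := low.filter fun v => ∃ x ∈ low, G.Adj v x
  let A := univ \ Y
  have hYlow : ∀ v ∈ Y, v ∈ low := fun v hv => (mem_filter.1 hv).1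
  have hYnb : ∀ v ∈ Y, ∀ x, G.Adj v x → x ∉ low := fun v hv => (mem_filter.1 hv).2
  have hYA : ∀ v ∈ Y, G.neighborFinset v ⊆ A := by
    intro v hv x hx
    rw [mem_neighborFinset] at hx
    exact mem_sdiff.2 ⟨mem_univ _, fun hxY => hYnb v hv x hx (hYlow x hxY)⟩
  have hbad : #bad ≤ coverBound L := by
    refine h.card_le_coverBound (Z := low) (U := univ) (fun a ha => ?_)
      (fun _ _ => subset_univ _) (fun z hz => (hlow z).1 hz) fun a ha => (mem_filter.1 ha).2
    rw [inter_univ, card_neighborFinset_eq_degree]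
    exact (hlow a).1 (mem_filter.1 ha).1
  let T := A.filter fun a => #(G.neighborFinset a ∩ A) ≤ L
  have hT : #T ≤ 2 * coverBound L := by
    let T₁ := T.filter fun a => ∃ z ∈ Y, G.Adj a z
    have h1 : #T₁ ≤ coverBound L :=
      h.card_le_coverBound (Z := Y) (U := A)
        (fun a ha => (mem_filter.1 (mem_filter.1 ha).1).2) hYA
        (fun z hz => (hlow z).1 (hYlow z hz)) fun a ha => (mem_filter.1 ha).2
    have h2 : T ⊆ T₁ ∪ bad := by
      intro a ha
      by_cases haY : ∃ z ∈ Y, G.Adj a z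
      · exact mem_union_left _ (mem_filter.2 ⟨ha, haY⟩)
      · push Not at haY
        obtain ⟨haA, hac⟩ := mem_filter.1 ha
        have hsub : G.neighborFinset a ⊆ A := fun x hx => by
          rw [mem_neighborFinset] at hx
          exact mem_sdiff.2 ⟨mem_univ _, fun hxY => haY x hxY hx⟩
        rw [inter_eq_left.2 hsub, card_neighborFinset_eq_degree, ← hlow] at hac
        refine mem_union_right _ (mem_filter.2 ⟨hac, ?_⟩)
        by_contra hcon
        push Not at hcon
        exact (mem_sdiff.1 haA).2 (mem_filter.2 ⟨hac, fun x hx hxl => hcon x hxl hx⟩)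
    have := (card_le_card h2).trans (card_union_le _ _)
    omega
  let I := Y.filter fun v => G.degree v = t
  have hIY : ∀ v ∈ I, v ∈ Y := fun v hv => (mem_filter.1 hv).1
  refine ⟨I, ⟨h, subset_univ _, fun u hu v hv huv => hYnb u (hIY u hu) v huv (hYlow v (hIY v hv)),
    fun u hu => (mem_filter.1 hu).2, fun u hu v hv huv => ?_⟩, ?_⟩
  · by_contra hne
    obtain ⟨w, hw, hwu, -⟩ := htw u v hne (Set.ext huv)
    refine hYnb u (hIY u hu) w hwu.symm ((hlow w).2 ?_)
    rw [← ncard_neighborSet, hw]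
    omega
  · obtain ⟨G₀, hG₀⟩ := G.exists_adj_iff_notMem Y
    have he := card_edgeFinset_add_sum_degree_le G G₀ Y (fun x y hxy => ((hG₀ x y).1 hxy).1)
      (fun x hx y hxy => ((hG₀ x y).1 hxy).2.1 hx)
      (fun x hx y hy hxy => hYnb x hx y hxy (hYlow y hy))
    have hS : t * #Y + #Y ≤ ∑ v ∈ Y, G.degree v + #I := by
      have : ∀ v ∈ Y, t + 1 ≤ G.degree v + if G.degree v = t then 1 else 0 := by
        intro v _
        have := hdeg' v
        split_ifs <;> omega
      have := sum_le_sum this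
      rw [sum_const, sum_add_distrib, ← card_filter, smul_eq_mul] at this
      calc t * #Y + #Y = #Y * (t + 1) := by ring
        _ ≤ ∑ v ∈ Y, G.degree v + #I := this
    have hD : (L + 1) * #A ≤ 2 * #G₀.edgeFinset + (L + 1) * #T := by
      rw [← G₀.sum_degrees_eq_twice_card_edges]
      have h1 : ∀ a ∈ A, L + 1 ≤
          G₀.degree a + (L + 1) * if #(G.neighborFinset a ∩ A) ≤ L then 1 else 0 := by
        intro a ha
        have h2 : G₀.neighborFinset a = G.neighborFinset a ∩ A := by
          ext x
          rw [mem_sdiff] at ha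
          simp [hG₀, ha.2, A]
        rw [← card_neighborFinset_eq_degree, h2]
        split_ifs <;> omega
      have h3 := sum_le_sum h1
      rw [sum_const, sum_add_distrib, ← mul_sum, ← card_filter, smul_eq_mul] at h3
      have h4 : ∑ a ∈ A, G₀.degree a ≤ ∑ a, G₀.degree a :=
        sum_le_sum_of_subset (subset_univ _)
      rw [mul_comm #A] at h3
      exact h3.trans (Nat.add_le_add_right h4 _)
    have hn : #A + #Y = Fintype.card V := by
      rw [card_sdiff_add_card_eq_card (subset_univ Y), card_univ]
    have h5 : (L + 1) * #T ≤ (L + 1) * (2 * coverBound L) := Nat.mul_le_mul_left _ hT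
    rw [← hn]
    have h6 : (L + 1) * #A = 2 * ((t + 1) * #A) := by rw [hL]; ring
    have h7 : (L + 1) * (2 * coverBound L) = 2 * (2 * (t + 1) * coverBound L) := by rw [hL]; ring
    rw [mul_add, add_mul t 1 #Y, one_mul]
    omega

end

section

open scoped Classical

theorem exists_lower_bound {k t : ℕ} (hk : 1 ≤ k) (ht : k + 5 ≤ t) :
    ∃ c : ℝ, 0 < c ∧ ∃ (N : ℕ) (f : ℕ → ℕ),
      Filter.Tendsto (fun n : ℕ => (f n : ℝ) / (n : ℝ)) Filter.atTop (nhds 1) ∧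
      ∀ n, N ≤ n → ∀ (V : Type) [Fintype V] (G : SimpleGraph V), Fintype.card V = n →
        Ksat (k + 2) G → MinDegGe G t → TwinCond G t →
        (t : ℝ) * n + c * (ePrime (k + 2) t (f n) : ℝ) ≤ (G.edgeSet.ncard : ℝ) := by
  obtain ⟨C, hC⟩ : ∃ C, C = 2 * (t + 1) * coverBound (2 * t + 1) := ⟨_, rfl⟩
  obtain ⟨f, N, hf, hfN⟩ := exists_lower_index (e := ePrime (k + 2) t)
    (ePrime_isLittleO hk ht) (ePrime_unbounded hk ht) (2 * (t * C)) C
  refine ⟨1 / (2 * ((t : ℝ) + 1)), by positivity, N, f, hf, fun n hn V _ G hV hG hdeg htw => ?_⟩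
  obtain ⟨hB, hmin⟩ := hfN n hn
  obtain ⟨I, hI, hle⟩ := hG.satOn_univ.exists_conf hdeg htw
  have he := hI.ePrime_add_le hk
  have hIn : I.card ≤ n := hV ▸ I.card_le_univ
  rw [hV, ← hC] at hle
  rw [ncard_edgeSet]
  set E := G.edgeFinset.card
  have ht0 : (0 : ℝ) ≤ t := t.cast_nonneg
  have hle' : ((t : ℝ) + 1) * n ≤ E + I.card + C := by exact_mod_cast hle
  have he' : (ePrime (k + 2) t I.card : ℝ) + t * I.card ≤ E := by exact_mod_cast he
  have hB' : 2 * ((t : ℝ) * C) ≤ ePrime (k + 2) t (f n) := by exact_mod_cast hB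
  have key : (ePrime (k + 2) t (f n) : ℝ) ≤ 2 * ((t : ℝ) + 1) * (E - t * n) := by
    by_cases hcase : n ≤ I.card + ePrime (k + 2) t n + C
    · have h1 : (ePrime (k + 2) t (f n) : ℝ) ≤ ePrime (k + 2) t I.card := by
        exact_mod_cast hmin _ hIn hcase
      have h2 : (t : ℝ) * (n - I.card) ≤ t * (E - t * n + C) :=
        mul_le_mul_of_nonneg_left (by linarith) ht0
      linarith
    · have h1 : (ePrime (k + 2) t (f n) : ℝ) ≤ ePrime (k + 2) t n := by
        exact_mod_cast hmin n le_rfl (by omega)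
      have h2 : (I.card : ℝ) + ePrime (k + 2) t n + C ≤ n := by
        exact_mod_cast (not_le.1 hcase).le
      have h3 : (0 : ℝ) ≤ ePrime (k + 2) t n := Nat.cast_nonneg _
      have h4 : (ePrime (k + 2) t n : ℝ) ≤ E - t * n := by linarith
      nlinarith
  have hpos : 0 < 2 * ((t : ℝ) + 1) := by positivity
  have := (div_le_iff₀' hpos).2 key
  rw [one_div_mul_eq_div]
  linarith

theorem exists_upper_bound {k t : ℕ} (hk : 1 ≤ k) (ht : k + 5 ≤ t) :
    ∃ C : ℝ, 0 < C ∧ ∃ (N : ℕ) (g : ℕ → ℕ),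
      Filter.Tendsto (fun n : ℕ => (g n : ℝ) / (n : ℝ)) Filter.atTop (nhds 1) ∧
      ∀ n, N ≤ n → ∃ G : SimpleGraph (Fin n), Ksat (k + 2) G ∧ MinDegGe G t ∧ TwinCond G t ∧
        (G.edgeSet.ncard : ℝ) ≤ (t : ℝ) * n + C * (ePrime (k + 2) t (g n) : ℝ) := by
  obtain ⟨g, N, C, hg, hgN⟩ := exists_upper_index (e := ePrime (k + 2) t)
    (ePrime_isLittleO hk ht) (ePrime_unbounded hk ht) (t := t) (by omega) fun s => by
      simpa using ((hasConf_all hk ht (s + 1)).ePrime_le hk).2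
  refine ⟨((1 + (t ^ 3 + t ^ 2) * (1 + t) + t ^ 2 * C : ℕ) : ℝ), by positivity, N, g, hg,
    fun n hn => ?_⟩
  obtain ⟨h1, h2, h3, h4⟩ := hgN n hn
  obtain ⟨G, hG, hdeg, htw, he⟩ := exists_graph_le hk (by omega) (hasConf_all hk ht _) h1 h2
  refine ⟨G, hG, hdeg, htw, ?_⟩
  set e := ePrime (k + 2) t (g n)
  have h5 : t ^ 2 * (g n - n) ≤ t ^ 2 * (C * e) := Nat.mul_le_mul_left _ (by omega)
  have h6 : (t ^ 3 + t ^ 2) * (e + t) ≤ (t ^ 3 + t ^ 2) * (e + t * e) :=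
    Nat.mul_le_mul_left _ (Nat.add_le_add_left (Nat.le_mul_of_pos_right _ h4) _)
  have h7 : (1 + (t ^ 3 + t ^ 2) * (1 + t) + t ^ 2 * C) * e =
      e + (t ^ 3 + t ^ 2) * (e + t * e) + t ^ 2 * (C * e) := by ring
  have h8 : G.edgeSet.ncard ≤ t * n + (1 + (t ^ 3 + t ^ 2) * (1 + t) + t ^ 2 * C) * e := by
    omega
  exact_mod_cast h8

end

/-- For `r ≥ 3`, `t ≥ r+3`:
`tn + Ω(e'_{r,t}(n+o(n))) ≤ tsat(n, K_r, t) ≤ tn + O(e'_{r,t}(n+o(n)))`. -/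
theorem stmt19 (r t : ℕ) (hr : 3 ≤ r) (ht : r + 3 ≤ t) :
    ∃ c C : ℝ, 0 < c ∧ 0 < C ∧ ∃ (N : ℕ) (f g : ℕ → ℕ),
      Filter.Tendsto (fun n : ℕ => (f n : ℝ) / (n : ℝ)) Filter.atTop (nhds 1) ∧
      Filter.Tendsto (fun n : ℕ => (g n : ℝ) / (n : ℝ)) Filter.atTop (nhds 1) ∧
      ∀ n : ℕ, N ≤ n →
        (∀ (V : Type) [Fintype V] (G : SimpleGraph V), Fintype.card V = n →
          Ksat r G → MinDegGe G t → TwinCond G t →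
          (t : ℝ) * n + c * (ePrime r t (f n) : ℝ) ≤ (G.edgeSet.ncard : ℝ)) ∧
        (∃ G : SimpleGraph (Fin n), Ksat r G ∧ MinDegGe G t ∧ TwinCond G t ∧
          (G.edgeSet.ncard : ℝ) ≤ (t : ℝ) * n + C * (ePrime r t (g n) : ℝ)) := by
  obtain ⟨k, rfl⟩ := Nat.exists_eq_add_of_le' (show 2 ≤ r by omega)
  obtain ⟨c, hc, N₁, f, hf, hlower⟩ := exists_lower_bound (k := k) (t := t) (by omega) (by omega)
  obtain ⟨C, hC, N₂, g, hg, hupper⟩ := exists_upper_bound (k := k) (t := t) (by omega) (by omega)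
  refine ⟨c, C, hc, hC, max N₁ N₂, f, g, hf, hg, fun n hn => ⟨?_, ?_⟩⟩
  · exact hlower n ((le_max_left _ _).trans hn)
  · exact hupper n ((le_max_right _ _).trans hn)
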